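/- Let λ: ℝ → (0,∞) satisfy the admissibility condition. For every integer N ≥ 0 there exist a constant C = C_N > 0 and an integer M = M_N ≥ 0 such that ‖ψ_j Op(a) ψ_k u‖_{L²(dq)} ≤ C |a|_{λ:M,0,0,t} ⟨j−k⟩^{−N} ‖u‖_{L²(dq)} for all t ∈ [0,1], all a ∈ BS^0_0(λ;t), all j, k ∈ ℤ and all u ∈ C_c^∞(ℝ^n), where ⟨j−k⟩ = (1+(j−k)²)^{1/2}. -/

import Mathlib

open MeasureTheory Real
open scoped BigOperators Classical

noncomputable section

/-- Points of `ℝⁿ`. The coordinate `q 0` plays the role of the radial variable `r`,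
the remaining coordinates are the angular variables `θ`. -/
abbrev Vec (n : ℕ) := Fin n → ℝ

/-- Complex-valued partial derivative in the coordinate direction `i`. -/
def pdC {n : ℕ} (i : Fin n) (f : Vec n → ℂ) : Vec n → ℂ :=
  fun x => fderiv ℝ f x (Pi.single i 1)

/-- Iterated (multiindex) partial derivative `∂^A f`. -/
def mpd {n : ℕ} (A : Fin n → ℕ) (f : Vec n → ℂ) : Vec n → ℂ :=
  (List.finRange n).foldr (fun i g => (pdC i)^[A i] g) f

/-- Real-valued partial derivative in the coordinate direction `i`. -/
def pdR {n : ℕ} (i : Fin n) (f : Vec n → ℝ) : Vec n → ℝ :=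
  fun x => fderiv ℝ f x (Pi.single i 1)

/-- Iterated (multiindex) partial derivative, real valued. -/
def mpdR {n : ℕ} (A : Fin n → ℕ) (f : Vec n → ℝ) : Vec n → ℝ :=
  (List.finRange n).foldr (fun i g => (pdR i)^[A i] g) f

/-- Total length `|A| = α₀ + |α|` of a multiindex. -/
def fullLen {n : ℕ} (A : Fin n → ℕ) : ℕ := ∑ i, A i

/-- Angular length `|α|` of a multiindex `A = (α₀, α)`. -/
def angLen {n : ℕ} [NeZero n] (A : Fin n → ℕ) : ℕ := ∑ i, if i = 0 then 0 else A i

/-- The weighted Japanese bracket `⟨ρ ⊕ μ⁻¹ η⟩ = (1 + ρ² + μ⁻²|η|²)^(1/2)`,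
where `ρ = p 0` and `η` are the remaining coordinates of `p`. -/
def jbr {n : ℕ} [NeZero n] (μ : ℝ) (p : Vec n) : ℝ :=
  Real.sqrt (1 + ∑ i, (if i = 0 then p i else μ⁻¹ * p i) ^ 2)

/-- Derivative `∂_q^A` of a function `a(q, p)` in the first slot. -/
def dqS {n : ℕ} (A : Fin n → ℕ) (a : Vec n → Vec n → ℂ) : Vec n → Vec n → ℂ :=
  fun q p => mpd A (fun x => a x p) q

/-- Derivative `∂_p^B` of a function `a(q, p)` in the second slot. -/
def dpS {n : ℕ} (B : Fin n → ℕ) (a : Vec n → Vec n → ℂ) : Vec n → Vec n → ℂ :=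
  fun q p => mpd B (fun x => a q x) p

/-- Derivative `∂_q^A` of a function `a(q, p, q')` in the first slot. -/
def d1B {n : ℕ} (A : Fin n → ℕ) (a : Vec n → Vec n → Vec n → ℂ) :
    Vec n → Vec n → Vec n → ℂ :=
  fun q p q' => mpd A (fun x => a x p q') q

/-- Derivative `∂_p^B` of a function `a(q, p, q')` in the second slot. -/
def d2B {n : ℕ} (B : Fin n → ℕ) (a : Vec n → Vec n → Vec n → ℂ) :
    Vec n → Vec n → Vec n → ℂ :=
  fun q p q' => mpd B (fun x => a q x q') p

/-- Derivative `∂_{q'}^{A'}` of a function `a(q, p, q')` in the third slot. -/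
def d3B {n : ℕ} (A' : Fin n → ℕ) (a : Vec n → Vec n → Vec n → ℂ) :
    Vec n → Vec n → Vec n → ℂ :=
  fun q p q' => mpd A' (fun x => a q p x) q'

/-- The admissibility condition for the weight `λ : ℝ → (0,∞)`:
`λ` is positive and `C₀⁻¹ ≤ λ(r)/λ(r') ≤ C₀` whenever `|r - r'| ≤ 1`. -/
def Admissible (lam : ℝ → ℝ) : Prop :=
  (∀ r, 0 < lam r) ∧
  ∃ C > 0, ∀ r r' : ℝ, |r - r'| ≤ 1 → C⁻¹ ≤ lam r / lam r' ∧ lam r / lam r' ≤ C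

/-- The symbol class `S^m_σ(λ)`:  `a` is smooth on `ℝ^{2n}` and for all multiindices
`A = (α₀, α)`, `B = (β₀, β)`,
`|(λ(r)⁻¹∂_θ)^α (λ(r)∂_η)^β ∂_r^{α₀} ∂_ρ^{β₀} a(q,p)| ≤ C ⟨ρ ⊕ λ(r)⁻¹η⟩^{m - σ|B|}`.
(The weights `λ(r)^{±1}` commute with the `θ`- and `η`-derivatives, so the weighted
derivative equals `λ(r)^{|β| - |α|}` times the plain mixed partial derivative.) -/
def IsSymbol {n : ℕ} [NeZero n] (lam : ℝ → ℝ) (m σ : ℝ) (a : Vec n → Vec n → ℂ) : Prop :=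
  ContDiff ℝ (⊤ : ℕ∞) (fun x : Vec n × Vec n => a x.1 x.2) ∧
  ∀ A B : Fin n → ℕ, ∃ C > 0, ∀ q p : Vec n,
    lam (q 0) ^ ((angLen B : ℤ) - (angLen A : ℤ)) * ‖dqS A (dpS B a) q p‖
      ≤ C * jbr (lam (q 0)) p ^ (m - σ * (fullLen B : ℝ))

/-- The seminorm `|a|_{λ : M, m, σ}` on the symbol class `S^m_σ(λ)`. -/
def symSeminorm {n : ℕ} [NeZero n] (lam : ℝ → ℝ) (M : ℕ) (m σ : ℝ)
    (a : Vec n → Vec n → ℂ) : ℝ :=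
  ∑ A : Fin n → Fin (M + 1), ∑ B : Fin n → Fin (M + 1),
    if fullLen (fun i => (A i : ℕ)) + fullLen (fun i => (B i : ℕ)) ≤ M then
      ⨆ q : Vec n, ⨆ p : Vec n,
        jbr (lam (q 0)) p ^ (-m + σ * (fullLen (fun i => (B i : ℕ)) : ℝ)) *
          (lam (q 0) ^ ((angLen (fun i => (B i : ℕ)) : ℤ) - (angLen (fun i => (A i : ℕ)) : ℤ)) *
            ‖dqS (fun i => (A i : ℕ)) (dpS (fun i => (B i : ℕ)) a) q p‖)
    else 0

/-- `λ^t_{jk} := λ(tj + (1-t)k)`. -/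
def lamT (lam : ℝ → ℝ) (t : ℝ) (j k : ℤ) : ℝ := lam (t * j + (1 - t) * k)

/-- The bisymbol class `BS^m_σ(λ; t)`. -/
def IsBisymbol {n : ℕ} [NeZero n] (lam : ℝ → ℝ) (m σ t : ℝ)
    (a : Vec n → Vec n → Vec n → ℂ) : Prop :=
  ContDiff ℝ (⊤ : ℕ∞) (fun x : Vec n × Vec n × Vec n => a x.1 x.2.1 x.2.2) ∧
  ∀ A B A' : Fin n → ℕ, ∃ C > 0, ∀ (j k : ℤ) (q p q' : Vec n),
    |q 0 - (j : ℝ)| ≤ 1 → |q' 0 - (k : ℝ)| ≤ 1 →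
    lamT lam t j k ^ ((angLen B : ℤ) - (angLen A : ℤ) - (angLen A' : ℤ)) *
        ‖d1B A (d2B B (d3B A' a)) q p q'‖
      ≤ C * jbr (lamT lam t j k) p ^ (m - σ * (fullLen B : ℝ))

/-- The seminorm `|a|_{λ : M, m, σ, t}` on `BS^m_σ(λ; t)`. -/
def bisymSeminorm {n : ℕ} [NeZero n] (lam : ℝ → ℝ) (M : ℕ) (m σ t : ℝ)
    (a : Vec n → Vec n → Vec n → ℂ) : ℝ :=
  ∑ A : Fin n → Fin (M + 1), ∑ B : Fin n → Fin (M + 1), ∑ A' : Fin n → Fin (M + 1),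
    if fullLen (fun i => (A i : ℕ)) + fullLen (fun i => (B i : ℕ))
        + fullLen (fun i => (A' i : ℕ)) ≤ M then
      ⨆ j : ℤ, ⨆ k : ℤ, ⨆ q : Vec n, ⨆ p : Vec n, ⨆ q' : Vec n,
        if |q 0 - (j : ℝ)| ≤ 1 ∧ |q' 0 - (k : ℝ)| ≤ 1 then
          jbr (lamT lam t j k) p ^ (-m + σ * (fullLen (fun i => (B i : ℕ)) : ℝ)) *
            (lamT lam t j k ^ ((angLen (fun i => (B i : ℕ)) : ℤ)
                - (angLen (fun i => (A i : ℕ)) : ℤ) - (angLen (fun i => (A' i : ℕ)) : ℤ)) *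
              ‖d1B (fun i => (A i : ℕ)) (d2B (fun i => (B i : ℕ))
                  (d3B (fun i => (A' i : ℕ)) a)) q p q'‖)
        else 0
    else 0

/-- The plain bisymbol class `BS^m_σ(1)` (the case `λ ≡ 1`). -/
def IsBisymbolOne {n : ℕ} [NeZero n] (m σ : ℝ) (a : Vec n → Vec n → Vec n → ℂ) : Prop :=
  ContDiff ℝ (⊤ : ℕ∞) (fun x : Vec n × Vec n × Vec n => a x.1 x.2.1 x.2.2) ∧
  ∀ A B A' : Fin n → ℕ, ∃ C > 0, ∀ q p q' : Vec n,
    ‖d1B A (d2B B (d3B A' a)) q p q'‖ ≤ C * jbr 1 p ^ (m - σ * (fullLen B : ℝ))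

/-- The seminorm `|a|_{M, m, σ}` on `BS^m_σ(1)`. -/
def bisymSeminormOne {n : ℕ} [NeZero n] (M : ℕ) (m σ : ℝ)
    (a : Vec n → Vec n → Vec n → ℂ) : ℝ :=
  ∑ A : Fin n → Fin (M + 1), ∑ B : Fin n → Fin (M + 1), ∑ A' : Fin n → Fin (M + 1),
    if fullLen (fun i => (A i : ℕ)) + fullLen (fun i => (B i : ℕ))
        + fullLen (fun i => (A' i : ℕ)) ≤ M then
      ⨆ q : Vec n, ⨆ p : Vec n, ⨆ q' : Vec n,
        jbr 1 p ^ (-m + σ * (fullLen (fun i => (B i : ℕ)) : ℝ)) *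
          ‖d1B (fun i => (A i : ℕ)) (d2B (fun i => (B i : ℕ))
              (d3B (fun i => (A' i : ℕ)) a)) q p q'‖
    else 0

/-- The oscillatory phase `e^{i p · (q - q')}`. -/
def phase {n : ℕ} (p q q' : Vec n) : ℂ :=
  Complex.exp (Complex.I * ((∑ i, p i * (q i - q' i) : ℝ) : ℂ))

/-- The pseudodifferential operator `Op^g(a)` with bisymbol `a`, as an iterated integral:
`Op^g(a)u(q) = (2π)^{-n} g(q)^{-1/4} ∫ dp ∫ dq' a(q,p,q') e^{ip⋅(q-q')} u(q') g(q')^{1/4}`. -/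
def OpG {n : ℕ} (g : Vec n → ℝ) (a : Vec n → Vec n → Vec n → ℂ) (u : Vec n → ℂ) :
    Vec n → ℂ :=
  fun q => (((2 * Real.pi) ^ (-(n : ℤ)) : ℝ) : ℂ) * ((g q ^ (-(1 : ℝ) / 4) : ℝ) : ℂ) *
    ∫ p : Vec n, ∫ q' : Vec n,
      a q p q' * phase p q q' * u q' * ((g q' ^ ((1 : ℝ) / 4) : ℝ) : ℂ)

/-- The pseudodifferential operator `Op(a) = Op^1(a)` with bisymbol `a`. -/
def Op {n : ℕ} (a : Vec n → Vec n → Vec n → ℂ) (u : Vec n → ℂ) : Vec n → ℂ :=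
  fun q => (((2 * Real.pi) ^ (-(n : ℤ)) : ℝ) : ℂ) *
    ∫ p : Vec n, ∫ q' : Vec n, a q p q' * phase p q q' * u q'

/-- The `t`-quantization `Op^{g,t}(a)` of a symbol `a`. -/
def OpSt {n : ℕ} (g : Vec n → ℝ) (t : ℝ) (a : Vec n → Vec n → ℂ) (u : Vec n → ℂ) :
    Vec n → ℂ :=
  OpG g (fun q p q' => a (t • q + (1 - t) • q') p) u

/-- The quantization `Op(b)` of a symbol `b` (the case `t = 1`, `g ≡ 1`). -/
def OpSym {n : ℕ} (b : Vec n → Vec n → ℂ) (u : Vec n → ℂ) : Vec n → ℂ :=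
  Op (fun q p _ => b q p) u

/-- The `L²(g^{1/2}dq)` norm. -/
def L2g {n : ℕ} (g : Vec n → ℝ) (f : Vec n → ℂ) : ℝ :=
  Real.sqrt (∫ q : Vec n, ‖f q‖ ^ 2 * Real.sqrt (g q))

/-- The `L²(dq)` norm. -/
def L2 {n : ℕ} (f : Vec n → ℂ) : ℝ :=
  Real.sqrt (∫ q : Vec n, ‖f q‖ ^ 2)

end

open FourierTransform in
/-- Plancherel's theorem for integrable, square-integrable functions. -/
theorem eLpNorm_fourier_eq_of_integrable {V : Type*} [NormedAddCommGroup V]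
    [InnerProductSpace ℝ V] [FiniteDimensional ℝ V] [MeasurableSpace V] [BorelSpace V]
    {f : V → ℂ} (h1 : Integrable f) (h2 : MemLp f 2) :
    MemLp (𝓕 f) 2 ∧ eLpNorm (𝓕 f) 2 volume = eLpNorm f 2 volume := by
  set g : Lp ℂ 2 (volume : Measure V) := 𝓕 (h2.toLp f) with hg
  have hcont : Continuous (𝓕 f) :=
    VectorFourier.fourierIntegral_continuous Real.continuous_fourierChar
      (by exact continuous_inner) h1
  have key : ∀ᵐ x : V, (g : V → ℂ) x = 𝓕 f x := by
    refine ae_eq_of_integral_contDiff_smul_eq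
      ((Lp.memLp g).locallyIntegrable (by norm_num)) hcont.locallyIntegrable ?_
    intro φ hφ hφs
    have hc : ContDiff ℝ (⊤ : ℕ∞) (fun x => (φ x : ℂ)) := Complex.ofRealCLM.contDiff.comp hφ
    have hs : HasCompactSupport (fun x => (φ x : ℂ)) :=
      hφs.comp_left (g := fun r : ℝ => (r : ℂ)) (by simp)
    set Φ : SchwartzMap V ℂ := hs.toSchwartzMap hc
    have hΦ : ∀ x, Φ x = (φ x : ℂ) := fun x => rfl
    have e1 : (g : TemperedDistribution V ℂ) Φ = ∫ x, Φ x • (g : V → ℂ) x :=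
      Lp.toTemperedDistribution_apply _ _
    have e2 : (g : TemperedDistribution V ℂ) Φ =
        ∫ x, (𝓕 Φ) x • ((h2.toLp f : Lp ℂ 2 _) : V → ℂ) x := by
      rw [hg, ← Lp.fourier_toTemperedDistribution_eq, TemperedDistribution.fourier_apply,
        Lp.toTemperedDistribution_apply]
    have e3 : ∫ x, (𝓕 Φ) x • ((h2.toLp f : Lp ℂ 2 _) : V → ℂ) x = ∫ x, (𝓕 Φ) x • f x := by
      refine integral_congr_ae ?_
      filter_upwards [h2.coeFn_toLp] with x hx
      rw [hx]
    have e4 : ∫ x, (𝓕 Φ) x • f x = ∫ x, Φ x • 𝓕 f x := by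
      have := VectorFourier.integral_fourierIntegral_smul_eq_flip (μ := volume) (ν := volume)
        (L := innerₗ V) (f := Φ) (g := f) Real.continuous_fourierChar
        (by exact continuous_inner) Φ.integrable h1
      simp only [flip_innerₗ] at this
      rw [SchwartzMap.fourier_coe]
      exact this
    have e5 : ∀ h : V → ℂ, ∫ x, φ x • h x = ∫ x, Φ x • h x := by
      intro h
      refine integral_congr_ae (Filter.Eventually.of_forall fun x => ?_)
      simp [hΦ]
    rw [e5, e5, ← e1, e2, e3, e4]
  have hae : (𝓕 f) =ᵐ[volume] (g : V → ℂ) := by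
    filter_upwards [key] with x hx using hx.symm
  refine ⟨(memLp_congr_ae hae).2 (Lp.memLp g), ?_⟩
  rw [eLpNorm_congr_ae hae]
  have := Lp.norm_fourier_eq (h2.toLp f)
  rw [← hg, Lp.norm_def, Lp.norm_toLp] at this
  exact (ENNReal.toReal_eq_toReal_iff' (Lp.eLpNorm_ne_top g) h2.2.ne).1 this

noncomputable section

/-- The character `e^{i p · x}`. -/
def osc {n : ℕ} (p x : Vec n) : ℂ := Complex.exp (Complex.I * ((∑ i, p i * x i : ℝ) : ℂ))

/-- The Fourier transform `∫ e^{i p · x} v(x) dx`. -/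
def ft {n : ℕ} (v : Vec n → ℂ) (p : Vec n) : ℂ := ∫ x, osc p x * v x

end

theorem norm_osc {n : ℕ} (p x : Vec n) : ‖osc p x‖ = 1 := by
  rw [osc, mul_comm]; exact Complex.norm_exp_ofReal_mul_I _

theorem continuous_osc {n : ℕ} : Continuous fun z : Vec n × Vec n => osc z.1 z.2 := by
  unfold osc; fun_prop

theorem phase_eq_osc_mul {n : ℕ} (p q q' : Vec n) :
    phase p q q' = osc p q * osc (-p) q' := by
  rw [phase, osc, osc, ← Complex.exp_add]
  congr 1
  push_cast
  rw [← mul_add, ← Finset.sum_add_distrib]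
  congr 1
  refine Finset.sum_congr rfl fun i _ => ?_
  simp; ring

theorem continuous_ft {n : ℕ} {v : Vec n → ℂ} (h1 : Integrable v) : Continuous (ft v) := by
  have hc : ∀ x : Vec n, Continuous fun p => osc p x := fun x =>
    continuous_osc.comp (continuous_id.prodMk continuous_const)
  have hc' : ∀ p : Vec n, Continuous fun x => osc p x := fun p =>
    continuous_osc.comp (continuous_const.prodMk continuous_id)
  refine continuous_of_dominated (bound := fun x => ‖v x‖)
    (fun p => (hc' p).aestronglyMeasurable.mul h1.1) (fun p => ?_) h1.norm ?_
  · exact Filter.Eventually.of_forall fun x => by rw [norm_mul, norm_osc, one_mul]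
  · exact Filter.Eventually.of_forall fun x => (hc x).mul continuous_const

open FourierTransform in
theorem ft_eq_fourier {n : ℕ} (v : Vec n → ℂ) (ξ : EuclideanSpace ℝ (Fin n)) :
    ft v ((-(2 * π)) • WithLp.ofLp ξ) = 𝓕 (fun x : EuclideanSpace ℝ (Fin n) => v x.ofLp) ξ := by
  rw [Real.fourier_eq', ft, ← (PiLp.volume_preserving_ofLp (Fin n)).integral_comp
    (MeasurableEquiv.toLp 2 (Fin n → ℝ)).symm.measurableEmbedding]
  refine integral_congr_ae (Filter.Eventually.of_forall fun x => ?_)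
  simp only [osc, smul_eq_mul, PiLp.inner_apply]
  congr 2
  rw [mul_comm]
  congr 2
  rw [Finset.mul_sum]
  refine Finset.sum_congr rfl fun i _ => ?_
  simp; ring

theorem memLp_ft {n : ℕ} {v : Vec n → ℂ} (h1 : Integrable v) (h2 : MemLp v 2) :
    MemLp (ft v) 2 ∧ ∫ p, ‖ft v p‖ ^ 2 = (2 * π) ^ n * ∫ x, ‖v x‖ ^ 2 := by
  have mp := PiLp.volume_preserving_ofLp (Fin n)
  have me : MeasurableEmbedding (WithLp.ofLp : EuclideanSpace ℝ (Fin n) → Vec n) :=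
    (MeasurableEquiv.toLp 2 (Fin n → ℝ)).symm.measurableEmbedding
  have h1' : Integrable (fun x : EuclideanSpace ℝ (Fin n) => v x.ofLp) :=
    (mp.integrable_comp_emb me).2 h1
  have h2' : MemLp (fun x : EuclideanSpace ℝ (Fin n) => v x.ofLp) 2 :=
    h2.comp_measurePreserving mp
  obtain ⟨ha, hb⟩ := eLpNorm_fourier_eq_of_integrable h1' h2'
  have hpi : (2 * π) ≠ 0 := by positivity
  have hfun : (FourierTransform.fourier fun x : EuclideanSpace ℝ (Fin n) => v x.ofLp) =
      (fun p : Vec n => ft v ((-(2 * π)) • p)) ∘ WithLp.ofLp := by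
    ext ξ; rw [Function.comp, ft_eq_fourier]
  have hm : MemLp (fun p : Vec n => ft v ((-(2 * π)) • p)) 2 := by
    rw [hfun] at ha
    have := ha.comp_measurePreserving (PiLp.volume_preserving_toLp (Fin n))
    exact this
  have hm2 : Integrable (fun p : Vec n => ‖ft v ((-(2 * π)) • p)‖ ^ 2) :=
    (memLp_two_iff_integrable_sq_norm hm.1).1 hm
  have hint : ∫ p : Vec n, ‖ft v ((-(2 * π)) • p)‖ ^ 2 = ∫ x, ‖v x‖ ^ 2 := by
    have e1 : ∫ ξ : EuclideanSpace ℝ (Fin n), ‖ft v ((-(2 * π)) • WithLp.ofLp ξ)‖ ^ 2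
        = ∫ p : Vec n, ‖ft v ((-(2 * π)) • p)‖ ^ 2 :=
      mp.integral_comp me (fun p : Vec n => ‖ft v ((-(2 * π)) • p)‖ ^ 2)
    have e2 : ∫ ξ : EuclideanSpace ℝ (Fin n), ‖v (WithLp.ofLp ξ)‖ ^ 2 = ∫ x, ‖v x‖ ^ 2 :=
      mp.integral_comp me (fun p : Vec n => ‖v p‖ ^ 2)
    rw [← e1, ← e2]
    have := congrArg ENNReal.toReal hb
    rw [ha.eLpNorm_eq_integral_rpow_norm (by norm_num) (by norm_num),
      h2'.eLpNorm_eq_integral_rpow_norm (by norm_num) (by norm_num)] at this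
    rw [ENNReal.toReal_ofReal (by positivity), ENNReal.toReal_ofReal (by positivity)] at this
    have h3 := Real.rpow_left_injOn (x := (ENNReal.toReal 2)⁻¹) (by norm_num)
      (Set.mem_ofPred.2 (by positivity)) (Set.mem_ofPred.2 (by positivity)) this
    simp only [ENNReal.toReal_ofNat, Real.rpow_two] at h3
    simpa only [ft_eq_fourier] using h3
  have hI : Integrable (fun p : Vec n => ‖ft v p‖ ^ 2) :=
    (integrable_comp_smul_iff volume (fun p : Vec n => ‖ft v p‖ ^ 2) (neg_ne_zero.2 hpi)).1 hm2
  refine ⟨(memLp_two_iff_integrable_sq_norm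
    (continuous_ft h1).aestronglyMeasurable).2 hI, ?_⟩
  have := Measure.integral_comp_smul volume (fun p : Vec n => ‖ft v p‖ ^ 2) (-(2 * π))
  rw [hint] at this
  rw [this]
  simp [abs_of_pos Real.pi_pos]

noncomputable section

/-- Directional derivative of `f` in the direction `v`. -/
def dd {E : Type*} [NormedAddCommGroup E] [NormedSpace ℝ E] (v : E) (f : E → ℂ) : E → ℂ :=
  fun z => fderiv ℝ f z v

/-- Iterated directional derivative along a list of directions. -/
def ddL {E : Type*} [NormedAddCommGroup E] [NormedSpace ℝ E] (L : List E) (f : E → ℂ) : E → ℂ :=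
  L.foldr dd f

end

section DirectionalDerivatives

variable {E F : Type*} [NormedAddCommGroup E] [NormedSpace ℝ E]
  [NormedAddCommGroup F] [NormedSpace ℝ F]

theorem ContDiff.dd {f : E → ℂ} (hf : ContDiff ℝ (⊤ : ℕ∞) f) (v : E) :
    ContDiff ℝ (⊤ : ℕ∞) (dd v f) :=
  (hf.fderiv_right (m := (⊤ : ℕ∞)) (by simp)).clm_apply contDiff_const

theorem ContDiff.ddL {f : E → ℂ} (hf : ContDiff ℝ (⊤ : ℕ∞) f) (L : List E) :
    ContDiff ℝ (⊤ : ℕ∞) (ddL L f) := by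
  induction L with
  | nil => exact hf
  | cons v L ih => exact ih.dd v

theorem ddL_append (L L' : List E) (f : E → ℂ) : ddL (L ++ L') f = ddL L (ddL L' f) := by
  simp [ddL]

theorem dd_comm {f : E → ℂ} (hf : ContDiff ℝ (⊤ : ℕ∞) f) (v w : E) :
    dd v (dd w f) = dd w (dd v f) := by
  have hd : ∀ z, DifferentiableAt ℝ (fderiv ℝ f) z := fun z =>
    (hf.fderiv_right (m := (⊤ : ℕ∞)) (by simp)).differentiable (by simp) z
  have h2 : ∀ (v w : E) z, dd v (dd w f) z = fderiv ℝ (fderiv ℝ f) z v w := by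
    intro v w z
    change fderiv ℝ (fun y => fderiv ℝ f y w) z v = _
    rw [fderiv_clm_apply (hd z) (differentiableAt_const w)]
    simp
  ext z
  rw [h2, h2]
  exact (hf.contDiffAt.isSymmSndFDerivAt
    (by simpa using WithTop.coe_le_coe.2 (le_top : (2 : ℕ∞) ≤ ⊤))) v w

theorem ddL_perm {L L' : List E} (h : L.Perm L') {f : E → ℂ} (hf : ContDiff ℝ (⊤ : ℕ∞) f) :
    ddL L f = ddL L' f := by
  induction h with
  | nil => rfl
  | cons v _ ih => exact congrArg (dd v) ih
  | swap v w L => exact dd_comm (hf.ddL L) w v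
  | trans _ _ h₁ h₂ => exact h₁.trans h₂

theorem dd_comp_affine {f : E → ℂ} (hf : ContDiff ℝ (⊤ : ℕ∞) f) (A : F →L[ℝ] E) (b : E) (v : F) :
    dd v (fun z => f (A z + b)) = fun z => dd (A v) f (A z + b) := by
  ext z
  have h1 : HasFDerivAt (fun z => A z + b) A z := A.hasFDerivAt.add_const b
  have h2 := ((hf.differentiable (by simp)) (A z + b)).hasFDerivAt
  have h3 : HasFDerivAt (fun z => f (A z + b)) ((fderiv ℝ f (A z + b)).comp A) z := h2.comp z h1
  simp only [dd]
  rw [h3.fderiv]; rfl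

theorem ddL_comp_affine {f : E → ℂ} (hf : ContDiff ℝ (⊤ : ℕ∞) f) (A : F →L[ℝ] E) (b : E)
    (L : List F) :
    ddL L (fun z => f (A z + b)) = fun z => ddL (L.map A) f (A z + b) := by
  induction L with
  | nil => rfl
  | cons v L ih =>
    change dd v (ddL L _) = _
    rw [ih]
    exact dd_comp_affine (hf.ddL _) A b v

theorem dd_add {f g : E → ℂ} (hf : ContDiff ℝ (⊤ : ℕ∞) f) (hg : ContDiff ℝ (⊤ : ℕ∞) g) (v : E) :
    dd v (fun z => f z + g z) = fun z => dd v f z + dd v g z := by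
  ext z
  simp only [dd]
  rw [fderiv_fun_add (hf.differentiable (by simp) z) (hg.differentiable (by simp) z)]
  rfl

theorem ddL_add {f g : E → ℂ} (hf : ContDiff ℝ (⊤ : ℕ∞) f) (hg : ContDiff ℝ (⊤ : ℕ∞) g)
    (L : List E) : ddL L (fun z => f z + g z) = fun z => ddL L f z + ddL L g z := by
  induction L with
  | nil => rfl
  | cons v L ih =>
    change dd v (ddL L _) = _
    rw [ih]
    exact dd_add (hf.ddL _) (hg.ddL _) v

theorem dd_mul {f g : E → ℂ} (hf : ContDiff ℝ (⊤ : ℕ∞) f) (hg : ContDiff ℝ (⊤ : ℕ∞) g) (v : E) :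
    dd v (fun z => f z * g z) = fun z => dd v f z * g z + f z * dd v g z := by
  ext z
  simp only [dd]
  rw [fderiv_fun_mul (hf.differentiable (by simp) z) (hg.differentiable (by simp) z)]
  simp; ring

theorem ddL_eq_zero_of_mem {L : List E} (h : (0 : E) ∈ L) (f : E → ℂ) : ddL L f = 0 := by
  induction L with
  | nil => simp at h
  | cons v L ih =>
    change dd v (ddL L f) = 0
    rcases List.mem_cons.1 h with h | h
    · ext z; simp [dd, ← h]
    · rw [ih h]; ext z; simp [dd]

theorem dd_translate {f : E → ℂ} {e : E} (h : ∀ z, f (z + e) = f z) (v z : E) :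
    dd v f (z + e) = dd v f z := by
  simp only [dd]
  rw [← fderiv_comp_add_right]
  simp only [h]

end DirectionalDerivatives

noncomputable section

/-- The space of triples `(q, q', p)`, arranged as `((q, q'), p)`. -/
abbrev PS (n : ℕ) := (Vec n × Vec n) × Vec n

/-- The position coordinates of `PS n`: those of `q` and those of `q'`. -/
abbrev Slot (n : ℕ) := Fin n ⊕ Fin n

/-- The coordinate directions of `PS n`: position slots, then momenta. -/
abbrev Dir (n : ℕ) := Slot n ⊕ Fin n

/-- The position coordinate functional. -/
def coord {n : ℕ} : Slot n → (PS n →L[ℝ] ℝ)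
  | Sum.inl i => (ContinuousLinearMap.proj (R := ℝ) (φ := fun _ : Fin n => ℝ) i).comp
      ((ContinuousLinearMap.fst ℝ (Vec n) (Vec n)).comp (ContinuousLinearMap.fst ℝ _ _))
  | Sum.inr i => (ContinuousLinearMap.proj (R := ℝ) (φ := fun _ : Fin n => ℝ) i).comp
      ((ContinuousLinearMap.snd ℝ (Vec n) (Vec n)).comp (ContinuousLinearMap.fst ℝ _ _))

/-- The coordinate unit vectors. -/
def dir {n : ℕ} : Dir n → PS n
  | Sum.inl (Sum.inl i) => ((Pi.single i 1, 0), 0)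
  | Sum.inl (Sum.inr i) => ((0, Pi.single i 1), 0)
  | Sum.inr i => ((0, 0), Pi.single i 1)

/-- The scaling weights: `h` for positions, `h⁻¹` for momenta. -/
def wt {n : ℕ} (h : Fin n → ℝ) : Dir n → ℝ
  | Sum.inl (Sum.inl i) => h i
  | Sum.inl (Sum.inr i) => h i
  | Sum.inr i => (h i)⁻¹

/-- The set of points whose position coordinates lie in a product of intervals. -/
def box {n : ℕ} (b : Slot n → ℝ) (h : Fin n → ℝ) : Set (PS n) :=
  {z | ∀ σ, coord σ z ∈ Set.Icc (b σ) (b σ + wt h (Sum.inl σ))}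

/-- Scaled derivative bounds of order at most `M` on the set `R`. -/
def SymBound {n : ℕ} (h : Fin n → ℝ) (R : Set (PS n)) (M : ℕ) (D : ℝ) (f : PS n → ℂ) : Prop :=
  ∀ L : List (Dir n), L.length ≤ M → ∀ z ∈ R,
    (L.map (wt h)).prod * ‖ddL (L.map dir) f z‖ ≤ D

/-- Freeze the position coordinate `σ` at the value `s`. -/
def freeze {n : ℕ} (σ : Slot n) (s : ℝ) (z : PS n) : PS n :=
  z + (s - coord σ z) • dir (Sum.inl σ)

end

section Symbols

variable {n : ℕ} {h : Fin n → ℝ} {R : Set (PS n)} {M : ℕ} {D : ℝ} {f : PS n → ℂ}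

@[simp] theorem coord_inl (i : Fin n) (z : PS n) : coord (Sum.inl i) z = z.1.1 i := rfl

@[simp] theorem coord_inr (i : Fin n) (z : PS n) : coord (Sum.inr i) z = z.1.2 i := rfl

theorem wt_pos (hh : ∀ i, 0 < h i) (τ : Dir n) : 0 < wt h τ := by
  rcases τ with (i | i) | i
  · exact hh i
  · exact hh i
  · exact inv_pos.2 (hh i)

theorem wt_prod_pos (hh : ∀ i, 0 < h i) (L : List (Dir n)) : 0 < (L.map (wt h)).prod := by
  refine List.prod_pos ?_
  simp only [List.mem_map]
  rintro _ ⟨τ, _, rfl⟩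
  exact wt_pos hh τ

theorem coord_dir_self (σ : Slot n) : coord σ (dir (Sum.inl σ)) = 1 := by
  rcases σ with i | i <;> simp [dir]

theorem coord_dir_of_ne {σ : Slot n} {τ : Dir n} (hne : τ ≠ Sum.inl σ) : coord σ (dir τ) = 0 := by
  rcases σ with i | i <;> rcases τ with (j | j) | j <;> simp [dir] at hne ⊢ <;>
    simp [Ne.symm hne]

theorem coord_freeze_self (σ : Slot n) (s : ℝ) (z : PS n) : coord σ (freeze σ s z) = s := by
  simp [freeze, coord_dir_self, -coord_inl, -coord_inr]

theorem coord_freeze_of_ne {σ τ : Slot n} (hne : σ ≠ τ) (s : ℝ) (z : PS n) :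
    coord τ (freeze σ s z) = coord τ z := by
  have : coord τ (dir (Sum.inl σ)) = 0 := coord_dir_of_ne (by simpa using hne)
  simp [freeze, this, -coord_inl, -coord_inr]

theorem freeze_coord (σ : Slot n) (z : PS n) : freeze σ (coord σ z) z = z := by simp [freeze]

theorem freeze_snd (σ : Slot n) (s : ℝ) (z : PS n) : (freeze σ s z).2 = z.2 := by
  rcases σ with i | i <;> simp [freeze, dir]

theorem continuous_freeze (σ : Slot n) : Continuous fun x : ℝ × PS n => freeze σ x.1 x.2 := by
  unfold freeze; fun_prop

theorem freeze_mem_box {b : Slot n → ℝ} {σ : Slot n} {s : ℝ}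
    (hs : s ∈ Set.Icc (b σ) (b σ + wt h (Sum.inl σ))) {z : PS n} (hz : z ∈ box b h) :
    freeze σ s z ∈ box b h := by
  intro τ
  by_cases hst : σ = τ
  · subst hst; rwa [coord_freeze_self]
  · rw [coord_freeze_of_ne hst]; exact hz τ

theorem freeze_translate_self (σ : Slot n) (s t : ℝ) (z : PS n) :
    freeze σ s (z + t • dir (Sum.inl σ)) = freeze σ s z := by
  simp only [freeze, map_add, map_smul, coord_dir_self, smul_eq_mul]
  module

theorem freeze_translate_of_ne {σ τ : Slot n} (hne : σ ≠ τ) (s t : ℝ) (z : PS n) :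
    freeze σ s (z + t • dir (Sum.inl τ)) = freeze σ s z + t • dir (Sum.inl τ) := by
  have : coord σ (dir (Sum.inl τ)) = 0 := coord_dir_of_ne (by simpa using hne.symm)
  simp only [freeze, map_add, map_smul, this, smul_eq_mul]
  module

/-- The linear part of `freeze`. -/
noncomputable def freezeLin (σ : Slot n) : PS n →L[ℝ] PS n :=
  ContinuousLinearMap.id ℝ _ - (coord σ).smulRight (dir (Sum.inl σ))

theorem freeze_eq (σ : Slot n) (s : ℝ) (z : PS n) :
    freeze σ s z = freezeLin σ z + s • dir (Sum.inl σ) := by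
  simp only [freeze, freezeLin, sub_smul, sub_apply,
    ContinuousLinearMap.smulRight_apply, ContinuousLinearMap.id_apply]
  abel

theorem ContDiff.comp_freeze (hf : ContDiff ℝ (⊤ : ℕ∞) f) (σ : Slot n) (s : ℝ) :
    ContDiff ℝ (⊤ : ℕ∞) (fun z => f (freeze σ s z)) := by
  simp only [freeze_eq]
  exact hf.comp ((freezeLin σ).contDiff.add contDiff_const)

theorem SymBound.mono {R' : Set (PS n)} {M' : ℕ} {D' : ℝ} (hf : SymBound h R M D f)
    (hR : R' ⊆ R) (hM : M' ≤ M) (hD : D ≤ D') : SymBound h R' M' D' f :=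
  fun L hL z hz => (hf L (hL.trans hM) z (hR hz)).trans hD

theorem SymBound.norm_le (hf : SymBound h R M D f) {z : PS n} (hz : z ∈ R) : ‖f z‖ ≤ D := by
  simpa [ddL] using hf [] (by simp) z hz

theorem ddL_map_concat (L : List (Dir n)) (τ : Dir n) (f : PS n → ℂ) :
    ddL ((L ++ [τ]).map dir) f = ddL (L.map dir) (_root_.dd (dir τ) f) := by
  rw [List.map_append, ddL_append]; rfl

theorem prod_map_concat (w : Dir n → ℝ) (L : List (Dir n)) (τ : Dir n) :
    ((L ++ [τ]).map w).prod = (L.map w).prod * w τ := by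
  simp

theorem SymBound.dd (hh : ∀ i, 0 < h i) (hf : SymBound h R (M + 1) D f) (τ : Dir n) :
    SymBound h R M (D / wt h τ) (dd (dir τ) f) := by
  intro L hL z hz
  have := hf (L ++ [τ]) (by simpa using hL) z hz
  rw [ddL_map_concat, prod_map_concat] at this
  rw [le_div_iff₀ (wt_pos hh τ)]
  calc _ = _ := by ring
    _ ≤ D := this

theorem SymBound.mul (hh : ∀ i, 0 < h i) {g : PS n → ℂ} {D' : ℝ} (hfs : ContDiff ℝ (⊤ : ℕ∞) f)
    (hgs : ContDiff ℝ (⊤ : ℕ∞) g) (hf : SymBound h R M D f) (hg : SymBound h R M D' g) :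
    SymBound h R M (2 ^ M * (D * D')) (fun z => f z * g z) := by
  intro L
  induction L using List.reverseRecOn generalizing M f g D D' with
  | nil =>
    intro _ z hz
    have h1 := hf.norm_le hz
    have h2 := hg.norm_le hz
    have hD : 0 ≤ D := (norm_nonneg _).trans h1
    have hD' : 0 ≤ D' := (norm_nonneg _).trans h2
    have h3 : ‖f z‖ * ‖g z‖ ≤ D * D' := by gcongr
    have h4 : (1 : ℝ) ≤ 2 ^ M := one_le_pow₀ (by norm_num)
    simp only [List.map_nil, List.prod_nil, one_mul, ddL, List.foldr_nil, norm_mul]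
    nlinarith [mul_nonneg hD hD']
  | append_singleton L τ ih =>
    intro hL z hz
    obtain ⟨M, rfl⟩ : ∃ M', M = M' + 1 := ⟨M - 1, by simp at hL; omega⟩
    have hL' : L.length ≤ M := by simpa using hL
    have h1 := ih (hfs.dd (dir τ)) hgs (hf.dd hh τ) (hg.mono subset_rfl (by omega) le_rfl) hL' z hz
    have h2 := ih hfs (hgs.dd (dir τ)) (hf.mono subset_rfl (by omega) le_rfl) (hg.dd hh τ) hL' z hz
    have hw := wt_pos hh τ
    have hP := wt_prod_pos hh L
    rw [ddL_map_concat, prod_map_concat, dd_mul hfs hgs,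
      ddL_add ((hfs.dd _).mul hgs) (hfs.mul (hgs.dd _))]
    set A := ddL (L.map dir) (fun z => _root_.dd (dir τ) f z * g z) z
    set B := ddL (L.map dir) (fun z => f z * _root_.dd (dir τ) g z) z
    calc _ ≤ ((L.map (wt h)).prod * wt h τ) * (‖A‖ + ‖B‖) := by gcongr; exact norm_add_le _ _
      _ = wt h τ * ((L.map (wt h)).prod * ‖A‖ + (L.map (wt h)).prod * ‖B‖) := by ring
      _ ≤ wt h τ * (2 ^ M * (D / wt h τ * D') + 2 ^ M * (D * (D' / wt h τ))) := by gcongr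
      _ = _ := by field_simp; ring

theorem SymBound.comp_freeze {b : Slot n → ℝ}
    (hfs : ContDiff ℝ (⊤ : ℕ∞) f) (hf : SymBound h (box b h) M D f) (σ : Slot n) {s : ℝ}
    (hs : s ∈ Set.Icc (b σ) (b σ + wt h (Sum.inl σ))) :
    SymBound h (box b h) M D (fun z => f (freeze σ s z)) := by
  intro L hL z hz
  have hz' := freeze_mem_box hs hz
  have key : ddL (L.map dir) (fun z => f (freeze σ s z)) =
      fun z => ddL ((L.map dir).map (freezeLin σ)) f (freeze σ s z) := by
    simp only [freeze_eq]
    exact ddL_comp_affine hfs _ _ _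
  rw [key]
  by_cases hσ : Sum.inl σ ∈ L
  · have h0 : (0 : PS n) ∈ (L.map dir).map (freezeLin σ) := by
      rw [List.map_map, List.mem_map]
      refine ⟨Sum.inl σ, hσ, ?_⟩
      simp [freezeLin, coord_dir_self]
    rw [ddL_eq_zero_of_mem h0]
    simpa using (norm_nonneg _).trans (hf.norm_le hz')
  · have h0 : (L.map dir).map (freezeLin σ) = L.map dir := by
      rw [List.map_map]
      refine List.map_congr_left fun τ hτ => ?_
      have : τ ≠ Sum.inl σ := fun h => hσ (h ▸ hτ)
      simp [freezeLin, coord_dir_of_ne this]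
    rw [h0]
    exact hf L hL _ hz'

end Symbols

/-- Measurable, bounded functions with bounded support. -/
structure BddSupp {n : ℕ} (v : Vec n → ℂ) : Prop where
  meas : Measurable v
  bdd : ∃ B, ∀ x, ‖v x‖ ≤ B
  supp : ∃ r, ∀ x, v x ≠ 0 → ‖x‖ ≤ r

/-- `v` vanishes outside the product of the intervals `[b i, b i + h i]`. -/
def SuppIn {n : ℕ} (b h : Fin n → ℝ) (v : Vec n → ℂ) : Prop :=
  ∀ x, v x ≠ 0 → ∀ i, x i ∈ Set.Icc (b i) (b i + h i)

/-- `f` vanishes for momenta of norm larger than `K`. -/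
def MomSupp {n : ℕ} (K : ℝ) (f : PS n → ℂ) : Prop := ∀ z, K < ‖z.2‖ → f z = 0

noncomputable section

/-- The oscillatory factor of the bilinear form below. -/
def kern {n : ℕ} (v u : Vec n → ℂ) (z : PS n) : ℂ :=
  osc z.2 z.1.1 * v z.1.1 * (osc (-z.2) z.1.2 * u z.1.2)

/-- The bilinear form `∫ f((x, y), p) e^{i p (x - y)} v(x) u(y)`. -/
def bil {n : ℕ} (f : PS n → ℂ) (v u : Vec n → ℂ) : ℂ := ∫ z, f z * kern v u z

end

theorem integrable_of_bdd_supp {α E : Type*} [MeasurableSpace α] [NormedAddCommGroup E]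
    {μ : Measure α} {g : α → E}
    (hm : AEStronglyMeasurable g μ) {S : Set α} (hS : μ S ≠ ⊤) {B : ℝ} (hB : ∀ x, ‖g x‖ ≤ B)
    (hsupp : ∀ x, g x ≠ 0 → x ∈ S) : Integrable g μ := by
  have : IntegrableOn g S μ :=
    Measure.integrableOn_of_bounded (M := B) hS hm (Filter.Eventually.of_forall hB)
  exact (integrableOn_iff_integrable_of_support_subset hsupp).1 this

section Bilinear

variable {n : ℕ} {h : Fin n → ℝ} {M : ℕ} {D K : ℝ} {f : PS n → ℂ} {u v : Vec n → ℂ}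

theorem BddSupp.mul_bdd (hv : BddSupp v) {w : Vec n → ℂ} (hw : Measurable w)
    (hb : ∀ x, v x ≠ 0 → ‖w x‖ ≤ 1) : BddSupp (fun x => w x * v x) := by
  obtain ⟨B, hB⟩ := hv.bdd
  obtain ⟨r, hr⟩ := hv.supp
  refine ⟨hw.mul hv.meas, ⟨B, fun x => ?_⟩, ⟨r, fun x hx => hr x (right_ne_zero_of_mul hx)⟩⟩
  by_cases hx : v x = 0
  · simpa [hx] using hB x
  · rw [norm_mul]
    exact (mul_le_of_le_one_left (norm_nonneg _) (hb x hx)).trans (hB x)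

theorem BddSupp.integrable (hv : BddSupp v) : Integrable v := by
  obtain ⟨B, hB⟩ := hv.bdd
  obtain ⟨r, hr⟩ := hv.supp
  exact integrable_of_bdd_supp hv.meas.aestronglyMeasurable
    (S := Metric.closedBall 0 r) measure_closedBall_lt_top.ne hB (by simpa using hr)

theorem BddSupp.integrable_sq (hv : BddSupp v) : Integrable (fun x => ‖v x‖ ^ 2) := by
  obtain ⟨B, hB⟩ := hv.bdd
  obtain ⟨r, hr⟩ := hv.supp
  refine integrable_of_bdd_supp (hv.meas.norm.pow_const 2).aestronglyMeasurable
    (S := Metric.closedBall 0 r) measure_closedBall_lt_top.ne (B := B ^ 2) (fun x => ?_) ?_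
  · rw [norm_pow, norm_norm]; gcongr; exact hB x
  · intro x hx
    simpa using hr x (by simpa using hx)

theorem BddSupp.memLp (hv : BddSupp v) : MemLp v 2 :=
  (memLp_two_iff_integrable_sq_norm hv.meas.aestronglyMeasurable).2 hv.integrable_sq

theorem L2_nonneg (v : Vec n → ℂ) : 0 ≤ L2 v := Real.sqrt_nonneg _

theorem L2_sq (v : Vec n → ℂ) : L2 v ^ 2 = ∫ x, ‖v x‖ ^ 2 :=
  Real.sq_sqrt (integral_nonneg fun _ => by positivity)

theorem BddSupp.L2_mono (hv : BddSupp v) {w : Vec n → ℂ} (hw : ∀ x, ‖w x‖ ≤ ‖v x‖) :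
    L2 w ≤ L2 v := by
  refine Real.sqrt_le_sqrt (integral_mono_of_nonneg (Filter.Eventually.of_forall fun x => ?_)
    hv.integrable_sq (Filter.Eventually.of_forall fun x => ?_))
  · simp only [Pi.zero_apply]; positivity
  · have := hw x
    dsimp only; gcongr

theorem measurable_kern (hv : BddSupp v) (hu : BddSupp u) : Measurable (kern v u) := by
  unfold kern
  have h1 : Continuous fun z : PS n => osc z.2 z.1.1 :=
    continuous_osc.comp (continuous_snd.prodMk (continuous_fst.comp continuous_fst))
  have h2 : Continuous fun z : PS n => osc (-z.2) z.1.2 :=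
    continuous_osc.comp (continuous_snd.neg.prodMk (continuous_snd.comp continuous_fst))
  exact (h1.measurable.mul (hv.meas.comp (measurable_fst.comp measurable_fst))).mul
    (h2.measurable.mul (hu.meas.comp (measurable_snd.comp measurable_fst)))

theorem norm_kern (v u : Vec n → ℂ) (z : PS n) : ‖kern v u z‖ = ‖v z.1.1‖ * ‖u z.1.2‖ := by
  simp [kern, norm_osc]

theorem kern_ne_zero {z : PS n} (hz : kern v u z ≠ 0) : v z.1.1 ≠ 0 ∧ u z.1.2 ≠ 0 := by
  rw [← norm_ne_zero_iff, norm_kern] at hz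
  exact ⟨norm_ne_zero_iff.1 (left_ne_zero_of_mul hz), norm_ne_zero_iff.1 (right_ne_zero_of_mul hz)⟩

/-- A bounded set of `PS n` carrying the integrands of `bil`. -/
theorem exists_carrier (hv : BddSupp v) (hu : BddSupp u) (K : ℝ) :
    ∃ S : Set (PS n), volume S ≠ ⊤ ∧ ∀ z, kern v u z ≠ 0 → ‖z.2‖ ≤ K → z ∈ S := by
  obtain ⟨r, hr⟩ := hv.supp
  obtain ⟨r', hr'⟩ := hu.supp
  refine ⟨(Metric.closedBall 0 r ×ˢ Metric.closedBall 0 r') ×ˢ Metric.closedBall 0 K, ?_, ?_⟩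
  · rw [Measure.volume_eq_prod, Measure.prod_prod, Measure.volume_eq_prod, Measure.prod_prod]
    exact ENNReal.mul_ne_top (ENNReal.mul_ne_top measure_closedBall_lt_top.ne
      measure_closedBall_lt_top.ne) measure_closedBall_lt_top.ne
  · intro z hz hK
    obtain ⟨h1, h2⟩ := kern_ne_zero hz
    exact ⟨⟨by simpa using hr _ h1, by simpa using hr' _ h2⟩, by simpa using hK⟩

theorem exists_norm_kern_le (hv : BddSupp v) (hu : BddSupp u) :
    ∃ B, 0 ≤ B ∧ ∀ z, ‖kern v u z‖ ≤ B := by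
  obtain ⟨B, hB⟩ := hv.bdd
  obtain ⟨B', hB'⟩ := hu.bdd
  have h0 : 0 ≤ B := (norm_nonneg _).trans (hB 0)
  have h0' : 0 ≤ B' := (norm_nonneg _).trans (hB' 0)
  refine ⟨B * B', by positivity, fun z => ?_⟩
  rw [norm_kern]
  exact mul_le_mul (hB _) (hB' _) (norm_nonneg _) h0

theorem integrable_mul_kern (hf : Measurable f) (hv : BddSupp v) (hu : BddSupp u)
    (hK : MomSupp K f) (hD : ∀ z, kern v u z ≠ 0 → ‖f z‖ ≤ D) :
    Integrable fun z => f z * kern v u z := by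
  obtain ⟨B, hB0, hB⟩ := exists_norm_kern_le hv hu
  obtain ⟨S, hS, hS'⟩ := exists_carrier hv hu K
  refine integrable_of_bdd_supp (hf.mul (measurable_kern hv hu)).aestronglyMeasurable
    hS (B := |D| * B) (fun z => ?_) fun z hz => ?_
  · by_cases hz : kern v u z = 0
    · simp [hz]; positivity
    · rw [norm_mul]
      exact mul_le_mul ((hD z hz).trans (le_abs_self D)) (hB z) (norm_nonneg _) (abs_nonneg _)
  · refine hS' z (right_ne_zero_of_mul hz) (not_lt.1 fun hlt => ?_)
    exact left_ne_zero_of_mul hz (hK z hlt)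

theorem mem_box_of_kern {b : Slot n → ℝ} (hv : SuppIn (fun i => b (Sum.inl i)) h v)
    (hu : SuppIn (fun i => b (Sum.inr i)) h u) {z : PS n} (hz : kern v u z ≠ 0) :
    z ∈ box b h := by
  obtain ⟨h1, h2⟩ := kern_ne_zero hz
  rintro (i | i)
  · exact hv _ h1 i
  · exact hu _ h2 i

theorem MomSupp.dd (hK : MomSupp K f) (τ : PS n) : MomSupp K (dd τ f) := by
  intro z hz
  have : f =ᶠ[nhds z] fun _ => 0 := by
    have ho : IsOpen {z : PS n | K < ‖z.2‖} := isOpen_lt continuous_const (by fun_prop)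
    filter_upwards [ho.mem_nhds hz] with y hy using hK y hy
  simp [_root_.dd, this.fderiv_eq]

theorem MomSupp.comp_freeze (hK : MomSupp K f) (σ : Slot n) (s : ℝ) :
    MomSupp K (fun z => f (freeze σ s z)) :=
  fun z hz => hK _ (by rwa [freeze_snd])

/-- The bilinear form of a Fourier multiplier is bounded by Plancherel's theorem. -/
theorem norm_bil_multiplier_le {m : Vec n → ℂ} (hm : Measurable m) (hv : BddSupp v)
    (hu : BddSupp u) (hK : MomSupp K fun z : PS n => m z.2) (hD : ∀ p, ‖m p‖ ≤ D) :
    ‖bil (fun z => m z.2) v u‖ ≤ (2 * π) ^ n * D * L2 v * L2 u := by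
  have hD0 : 0 ≤ D := (norm_nonneg _).trans (hD 0)
  have hint := integrable_mul_kern (f := fun z : PS n => m z.2) (hm.comp measurable_snd) hv hu hK
    (fun z _ => hD z.2)
  have e1 : bil (fun z => m z.2) v u = ∫ p, m p * (ft v p * ft u (-p)) := by
    rw [bil, Measure.volume_eq_prod, integral_prod_symm _ hint]
    refine integral_congr_ae (Filter.Eventually.of_forall fun p => ?_)
    simp only [kern]
    rw [integral_const_mul, Measure.volume_eq_prod,
      integral_prod_mul (fun x => osc p x * v x) (fun y => osc (-p) y * u y)]
    rfl
  obtain ⟨hv1, hv2⟩ := memLp_ft hv.integrable hv.memLp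
  obtain ⟨hu1, hu2⟩ := memLp_ft hu.integrable hu.memLp
  have hu1' : MemLp (fun p => ft u (-p)) 2 :=
    hu1.comp_measurePreserving (Measure.measurePreserving_neg _)
  have hu2' : ∫ p, ‖ft u (-p)‖ ^ 2 = (2 * π) ^ n * ∫ x, ‖u x‖ ^ 2 := by
    rw [← hu2]; exact integral_neg_eq_self (fun p => ‖ft u p‖ ^ 2) _
  have hmul : Integrable fun p => ‖ft v p‖ * ‖ft u (-p)‖ := hv1.norm.integrable_mul hu1'.norm
  have hol : ∫ p, ‖ft v p‖ * ‖ft u (-p)‖ ≤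
      (∫ p, ‖ft v p‖ ^ (2 : ℝ)) ^ (1 / (2 : ℝ)) * (∫ p, ‖ft u (-p)‖ ^ (2 : ℝ)) ^ (1 / (2 : ℝ)) :=
    integral_mul_norm_le_Lp_mul_Lq Real.HolderConjugate.two_two (by simpa using hv1)
      (by simpa using hu1')
  simp only [Real.rpow_two, ← Real.sqrt_eq_rpow] at hol
  rw [hv2, hu2', Real.sqrt_mul (by positivity), Real.sqrt_mul (by positivity)] at hol
  rw [e1]
  have hs : √((2 * π) ^ n) * √((2 * π) ^ n) = (2 * π) ^ n := Real.mul_self_sqrt (by positivity)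
  calc _ ≤ ∫ p, D * (‖ft v p‖ * ‖ft u (-p)‖) := by
        refine norm_integral_le_of_norm_le (hmul.const_mul D)
          (Filter.Eventually.of_forall fun p => ?_)
        rw [norm_mul, norm_mul]
        gcongr; exact hD p
    _ = D * ∫ p, ‖ft v p‖ * ‖ft u (-p)‖ := integral_const_mul _ _
    _ ≤ D * (√((2 * π) ^ n) * L2 v * (√((2 * π) ^ n) * L2 u)) := by gcongr; exact hol
    _ = D * (√((2 * π) ^ n) * √((2 * π) ^ n)) * L2 v * L2 u := by ring
    _ = _ := by rw [hs]; ring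

end Bilinear

section SobolevStep

variable {n : ℕ} {h : Fin n → ℝ} {b : Slot n → ℝ} {M : ℕ} {D K : ℝ} {f : PS n → ℂ}
  {u v : Vec n → ℂ}

theorem exists_truncation (hv : BddSupp v) (hu : BddSupp u) (σ : Slot n) (s : ℝ) :
    ∃ v' u' : Vec n → ℂ, BddSupp v' ∧ BddSupp u' ∧ (∀ x, ‖v' x‖ ≤ ‖v x‖) ∧
      (∀ x, ‖u' x‖ ≤ ‖u x‖) ∧
      ∀ z, kern v' u' z = if s ≤ coord σ z then kern v u z else 0 := by
  have hmeas : ∀ i : Fin n, Measurable fun x : Vec n => if s ≤ x i then (1 : ℂ) else 0 := fun i =>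
    Measurable.ite (measurableSet_le measurable_const (measurable_pi_apply i))
      measurable_const measurable_const
  have hle : ∀ (i : Fin n) (x : Vec n), ‖if s ≤ x i then (1 : ℂ) else 0‖ ≤ 1 := by
    intro i x; split_ifs <;> simp
  have hle' : ∀ (i : Fin n) (w : Vec n → ℂ) (x : Vec n),
      ‖(if s ≤ x i then (1 : ℂ) else 0) * w x‖ ≤ ‖w x‖ := by
    intro i w x
    rw [norm_mul]
    exact mul_le_of_le_one_left (norm_nonneg _) (hle i x)
  rcases σ with i | i
  · refine ⟨_, u, hv.mul_bdd (hmeas i) fun x _ => hle i x, hu, hle' i v, fun _ => le_rfl,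
      fun z => ?_⟩
    simp only [coord_inl, kern]
    by_cases hs : s ≤ z.1.1 i <;> simp [hs]
  · refine ⟨v, _, hv, hu.mul_bdd (hmeas i) fun x _ => hle i x, fun _ => le_rfl, hle' i u,
      fun z => ?_⟩
    simp only [coord_inr, kern]
    by_cases hs : s ≤ z.1.2 i <;> simp [hs]

theorem hasDerivAt_freeze (hf : ContDiff ℝ (⊤ : ℕ∞) f) (σ : Slot n) (z : PS n) (s : ℝ) :
    HasDerivAt (fun s => f (freeze σ s z)) (dd (dir (Sum.inl σ)) f (freeze σ s z)) s := by
  have h1 : HasDerivAt (fun s => freeze σ s z) (dir (Sum.inl σ)) s := by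
    have := (((hasDerivAt_id s).sub_const (coord σ z)).smul_const (dir (Sum.inl σ))).const_add z
    simpa [freeze] using this
  exact ((hf.differentiable (by simp)) _).hasFDerivAt.comp_hasDerivAt s h1

theorem continuous_dd_freeze (hf : ContDiff ℝ (⊤ : ℕ∞) f) (σ : Slot n) :
    Continuous fun x : ℝ × PS n => dd (dir (Sum.inl σ)) f (freeze σ x.1 x.2) :=
  (hf.dd _).continuous.comp (continuous_freeze σ)

/-- The fundamental theorem of calculus in the coordinate `σ`. -/
theorem eq_add_integral_freeze (hf : ContDiff ℝ (⊤ : ℕ∞) f) {σ : Slot n} {z : PS n} {c w : ℝ}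
    (hz : coord σ z ∈ Set.Icc c (c + w)) :
    f z = f (freeze σ c z) + ∫ s in Set.Ioc c (c + w),
      if s ≤ coord σ z then dd (dir (Sum.inl σ)) f (freeze σ s z) else 0 := by
  have hcont : Continuous fun s => dd (dir (Sum.inl σ)) f (freeze σ s z) :=
    (continuous_dd_freeze hf σ).comp (continuous_id.prodMk continuous_const)
  have h1 := intervalIntegral.integral_eq_sub_of_hasDerivAt (a := c) (b := coord σ z)
    (fun s _ => hasDerivAt_freeze hf σ z s) (hcont.intervalIntegrable _ _)
  rw [freeze_coord, intervalIntegral.integral_of_le hz.1] at h1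
  have h2 : ∫ s in Set.Ioc c (c + w),
      (if s ≤ coord σ z then dd (dir (Sum.inl σ)) f (freeze σ s z) else 0) =
      ∫ s in Set.Ioc c (coord σ z), dd (dir (Sum.inl σ)) f (freeze σ s z) := by
    have : (fun s => if s ≤ coord σ z then dd (dir (Sum.inl σ)) f (freeze σ s z) else 0) =
        (Set.Iic (coord σ z)).indicator fun s => dd (dir (Sum.inl σ)) f (freeze σ s z) := by
      ext s; simp [Set.indicator_apply]
    rw [this, setIntegral_indicator measurableSet_Iic, Set.Ioc_inter_Iic,
      min_eq_right hz.2]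
  rw [h2, h1]; ring

theorem bil_eq_add_integral (hh : ∀ i, 0 < h i) (hf : ContDiff ℝ (⊤ : ℕ∞) f)
    (hS : SymBound h (box b h) (M + 1) D f) (hK : MomSupp K f) (hv : BddSupp v) (hu : BddSupp u)
    (hvs : SuppIn (fun i => b (Sum.inl i)) h v) (hus : SuppIn (fun i => b (Sum.inr i)) h u)
    (σ : Slot n) :
    bil f v u = bil (fun z => f (freeze σ (b σ) z)) v u +
      ∫ s in Set.Ioc (b σ) (b σ + wt h (Sum.inl σ)),
        ∫ z, (if s ≤ coord σ z then dd (dir (Sum.inl σ)) f (freeze σ s z) else 0) *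
          kern v u z := by
  set w := wt h (Sum.inl σ)
  have hw : 0 < w := wt_pos hh _
  set I := Set.Ioc (b σ) (b σ + w)
  set G : ℝ → PS n → ℂ := fun s z =>
    (if s ≤ coord σ z then dd (dir (Sum.inl σ)) f (freeze σ s z) else 0) * kern v u z with hG
  have hbσ : b σ ∈ Set.Icc (b σ) (b σ + w) := ⟨le_rfl, by linarith⟩
  have hint : Integrable (Function.uncurry G) ((volume.restrict I).prod volume) := by
    obtain ⟨B, hB0, hB⟩ := exists_norm_kern_le hv hu
    obtain ⟨S, hSf, hSS⟩ := exists_carrier hv hu K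
    have hmeas : Measurable (Function.uncurry G) := by
      refine Measurable.mul (Measurable.ite ?_ (continuous_dd_freeze hf σ).measurable
        measurable_const) ((measurable_kern hv hu).comp measurable_snd)
      exact measurableSet_le measurable_fst ((coord σ).continuous.measurable.comp measurable_snd)
    have hind : Integrable ((I ×ˢ Set.univ).indicator (Function.uncurry G))
        ((volume.restrict I).prod volume) := by
      refine integrable_of_bdd_supp
        (hmeas.indicator (measurableSet_Ioc.prod MeasurableSet.univ)).aestronglyMeasurable
        (S := I ×ˢ S) (B := |D / w| * B) ?_ ?_ ?_
      · rw [Measure.prod_prod]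
        exact ENNReal.mul_ne_top (by simp [I]) hSf
      · rintro ⟨s, z⟩
        by_cases hs : s ∈ I
        · rw [Set.indicator_of_mem (by simpa using hs)]
          simp only [Function.uncurry, hG]
          by_cases hz : kern v u z = 0
          · simp [hz]; positivity
          · rw [norm_mul]
            refine mul_le_mul ?_ (hB z) (norm_nonneg _) (abs_nonneg _)
            split_ifs
            · exact ((hS.dd hh _).norm_le (freeze_mem_box (Set.Ioc_subset_Icc_self hs)
                (mem_box_of_kern hvs hus hz))).trans (le_abs_self _)
            · simp
        · rw [Set.indicator_of_notMem (by simpa using hs)]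
          simp only [norm_zero]; positivity
      · rintro ⟨s, z⟩ hsz
        have hs : s ∈ I := by
          by_contra hs
          exact hsz (Set.indicator_of_notMem (by simpa using hs) _)
        rw [Set.indicator_of_mem (by simpa using hs)] at hsz
        simp only [Function.uncurry, hG] at hsz
        refine ⟨hs, hSS z (right_ne_zero_of_mul hsz) (not_lt.1 fun hlt => ?_)⟩
        refine left_ne_zero_of_mul hsz ?_
        rw [hK.dd _ _ (by rwa [freeze_snd])]
        simp
    refine hind.congr ?_
    have : ∀ᵐ x ∂((volume.restrict I).prod (volume : Measure (PS n))), x.1 ∈ I :=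
      Measure.quasiMeasurePreserving_fst.ae (ae_restrict_mem measurableSet_Ioc)
    filter_upwards [this] with x hx
    rw [Set.indicator_of_mem (by simpa using hx)]
  rw [integral_integral_swap hint, bil, bil, ← integral_add]
  · refine integral_congr_ae (Filter.Eventually.of_forall fun z => ?_)
    simp only [hG]
    rw [integral_mul_const]
    by_cases hz : kern v u z = 0
    · simp [hz]
    · rw [← add_mul, ← eq_add_integral_freeze hf (mem_box_of_kern hvs hus hz σ)]
  · exact integrable_mul_kern (D := D) (hf.comp_freeze _ _).continuous.measurable hv hu
      (hK.comp_freeze _ _) fun z hz =>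
        hS.norm_le (freeze_mem_box hbσ (mem_box_of_kern hvs hus hz))
  · exact hint.integral_prod_right

theorem corner_mem_box (hh : ∀ i, 0 < h i) (p : Vec n) :
    (((fun i => b (Sum.inl i)), fun i => b (Sum.inr i)), p) ∈ box b h := by
  rintro (i | i) <;> exact ⟨le_rfl, le_add_of_nonneg_right (wt_pos hh _).le⟩

theorem eq_of_translate_invariant (hf : ∀ σ (z : PS n) (t : ℝ), f (z + t • dir (Sum.inl σ)) = f z)
    (x y : Vec n) (z : PS n) : f z = f ((x, y), z.2) := by
  have key : ∀ (S : Finset (Slot n)) (t : Slot n → ℝ) (z : PS n),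
      f (z + ∑ σ ∈ S, t σ • dir (Sum.inl σ)) = f z := by
    intro S t z
    induction S using Finset.induction_on with
    | empty => simp
    | insert σ S hσ ih => rw [Finset.sum_insert hσ, add_comm (_ • _), ← add_assoc, hf, ih]
  rw [← key Finset.univ (Sum.elim (fun i => x i - z.1.1 i) fun i => y i - z.1.2 i) z]
  congr 1
  have h1 : ∀ w : Vec n, ∑ i, w i • (Pi.single i 1 : Vec n) = w := fun w => by
    ext j; simp [Finset.sum_apply, Pi.single_apply]
  have h2 : ∑ σ : Slot n, Sum.elim (fun i => x i - z.1.1 i) (fun i => y i - z.1.2 i) σ •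
      (dir (Sum.inl σ) : PS n) = ((x - z.1.1, y - z.1.2), 0) := by
    rw [Fintype.sum_sum_type]
    have h3 := h1 (x - z.1.1)
    have h4 := h1 (y - z.1.2)
    ext1
    · ext1
      · simpa [dir, Prod.fst_sum] using h3
      · simpa [dir, Prod.fst_sum, Prod.snd_sum] using h4
    · simp [dir, Prod.snd_sum]
  rw [h2]
  ext1
  · ext1 <;> simp
  · simp

theorem norm_bil_le_of_invariant (hh : ∀ i, 0 < h i) (S : Finset (Slot n)) :
    ∀ {M : ℕ} {D : ℝ} {f : PS n → ℂ} {v u : Vec n → ℂ}, S.card ≤ M →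
    ContDiff ℝ (⊤ : ℕ∞) f → SymBound h (box b h) M D f → MomSupp K f →
    BddSupp v → BddSupp u →
    SuppIn (fun i => b (Sum.inl i)) h v → SuppIn (fun i => b (Sum.inr i)) h u →
    (∀ σ ∉ S, ∀ (z : PS n) (t : ℝ), f (z + t • dir (Sum.inl σ)) = f z) →
    ‖bil f v u‖ ≤ 2 ^ S.card * ((2 * π) ^ n * D * L2 v * L2 u) := by
  induction S using Finset.induction_on with
  | empty =>
    intro M D f v u _ hf hS hK hv hu hvs hus hinv
    set x₀ : Vec n := fun i => b (Sum.inl i)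
    set y₀ : Vec n := fun i => b (Sum.inr i)
    have hfe : f = fun z => f ((x₀, y₀), z.2) :=
      funext fun z => eq_of_translate_invariant (fun σ => hinv σ (by simp)) x₀ y₀ z
    rw [hfe]
    simpa using norm_bil_multiplier_le (m := fun p => f ((x₀, y₀), p)) (D := D)
      (hf.continuous.comp (continuous_const.prodMk continuous_id)).measurable hv hu
      (fun z hz => hK _ hz) (fun p => hS.norm_le (corner_mem_box hh p))
  | insert σ S hσ ih =>
    intro M D f v u hM hf hS hK hv hu hvs hus hinv
    rw [Finset.card_insert_of_notMem hσ] at hM ⊢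
    obtain ⟨M, rfl⟩ : ∃ M', M = M' + 1 := ⟨M - 1, by omega⟩
    set w := wt h (Sum.inl σ)
    have hw : 0 < w := wt_pos hh _
    have hbσ : b σ ∈ Set.Icc (b σ) (b σ + w) := ⟨le_rfl, by linarith⟩
    have invf : ∀ {g : PS n → ℂ} (s : ℝ),
        (∀ τ ∉ insert σ S, ∀ (z : PS n) (t : ℝ), g (z + t • dir (Sum.inl τ)) = g z) →
        ∀ τ ∉ S, ∀ (z : PS n) (t : ℝ),
          g (freeze σ s (z + t • dir (Sum.inl τ))) = g (freeze σ s z) := by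
      intro g s hg τ hτ z t
      by_cases hτσ : σ = τ
      · subst hτσ; rw [freeze_translate_self]
      · rw [freeze_translate_of_ne hτσ, hg τ (by simp [hτ, Ne.symm hτσ])]
    rw [bil_eq_add_integral hh hf hS hK hv hu hvs hus σ]
    set X := (2 * π) ^ n * D * L2 v * L2 u with hX
    have h1 : ‖bil (fun z => f (freeze σ (b σ) z)) v u‖ ≤ 2 ^ S.card * X :=
      ih (by omega) (hf.comp_freeze _ _) (hS.comp_freeze hf σ hbσ) (hK.comp_freeze _ _)
        hv hu hvs hus (invf _ hinv)
    have hD0 : 0 ≤ D := (norm_nonneg _).trans (hS.norm_le (corner_mem_box hh 0))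
    have h2 : ∀ s ∈ Set.Ioc (b σ) (b σ + w),
        ‖∫ z, (if s ≤ coord σ z then dd (dir (Sum.inl σ)) f (freeze σ s z) else 0) *
          kern v u z‖ ≤ 2 ^ S.card * (X / w) := by
      intro s hs
      have hs' := Set.Ioc_subset_Icc_self hs
      obtain ⟨v', u', hv', hu', hvv, huu, hker⟩ := exists_truncation hv hu σ s
      have e : ∫ z, (if s ≤ coord σ z then dd (dir (Sum.inl σ)) f (freeze σ s z) else 0) *
          kern v u z = bil (fun z => dd (dir (Sum.inl σ)) f (freeze σ s z)) v' u' := by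
        refine integral_congr_ae (Filter.Eventually.of_forall fun z => ?_)
        simp only [hker]
        split_ifs <;> simp
      rw [e]
      have hne : ∀ {a c : Vec n → ℂ}, (∀ x, ‖a x‖ ≤ ‖c x‖) → ∀ x, a x ≠ 0 → c x ≠ 0 :=
        fun hac x hx => norm_pos_iff.1 ((norm_pos_iff.2 hx).trans_le (hac x))
      refine (ih (M := M) (D := D / w) (by omega) ((hf.dd _).comp_freeze _ _)
        ((hS.dd hh _).comp_freeze (hf.dd _) σ hs') ((hK.dd _).comp_freeze _ _) hv' hu'
        (fun x hx => hvs x (hne hvv x hx)) (fun x hx => hus x (hne huu x hx))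
        (invf (g := dd (dir (Sum.inl σ)) f) s fun τ hτ z t =>
          dd_translate (fun z => hinv τ hτ z t) _ z)).trans ?_
      have := hv.L2_mono hvv
      have := hu.L2_mono huu
      have := L2_nonneg v
      have := L2_nonneg v'
      have := L2_nonneg u'
      calc _ ≤ (2 : ℝ) ^ S.card * ((2 * π) ^ n * (D / w) * L2 v * L2 u) := by gcongr
        _ = _ := by rw [hX]; ring
    have h3 := norm_setIntegral_le_of_norm_le_const (μ := volume) (by simp) h2
    have hvol : (volume : Measure ℝ).real (Set.Ioc (b σ) (b σ + w)) = w := by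
      simp [Measure.real, hw.le]
    rw [hvol] at h3
    calc _ ≤ 2 ^ S.card * X + 2 ^ S.card * (X / w) * w := (norm_add_le _ _).trans (add_le_add h1 h3)
      _ = _ := by field_simp; ring

/-- Boundedness of the bilinear form localised to a single box. -/
theorem norm_bil_le (hh : ∀ i, 0 < h i) (hM : 2 * n ≤ M) (hf : ContDiff ℝ (⊤ : ℕ∞) f)
    (hS : SymBound h (box b h) M D f) (hK : MomSupp K f) (hv : BddSupp v) (hu : BddSupp u)
    (hvs : SuppIn (fun i => b (Sum.inl i)) h v) (hus : SuppIn (fun i => b (Sum.inr i)) h u) :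
    ‖bil f v u‖ ≤ 4 ^ n * (2 * π) ^ n * D * L2 v * L2 u := by
  have hc : (Finset.univ : Finset (Slot n)).card = 2 * n := by simp; ring
  have := norm_bil_le_of_invariant hh Finset.univ (hc.trans_le hM) hf hS hK hv hu hvs hus (by simp)
  rw [hc, pow_mul] at this
  calc _ ≤ _ := this
    _ = _ := by norm_num; ring

end SobolevStep

section Decay

variable {n : ℕ} {h : Fin n → ℝ} {b : Slot n → ℝ} {M : ℕ} {D K : ℝ} {f : PS n → ℂ}
  {u v : Vec n → ℂ}

theorem integrable_mul_kern_of_continuous (hf : Continuous f) (hv : BddSupp v) (hu : BddSupp u)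
    (hK : MomSupp K f) : Integrable fun z => f z * kern v u z := by
  obtain ⟨r, hr⟩ := hv.supp
  obtain ⟨r', hr'⟩ := hu.supp
  obtain ⟨B, hB⟩ := (((isCompact_closedBall (0 : Vec n) r).prod
    (isCompact_closedBall (0 : Vec n) r')).prod
    (isCompact_closedBall (0 : Vec n) K)).exists_bound_of_continuousOn hf.continuousOn
  refine integrable_mul_kern (D := max B 0) hf.measurable hv hu hK fun z hz => ?_
  obtain ⟨h1, h2⟩ := kern_ne_zero hz
  by_cases hzK : ‖z.2‖ ≤ K
  · exact (hB z ⟨⟨by simpa using hr _ h1, by simpa using hr' _ h2⟩, by simpa using hzK⟩).trans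
      (le_max_left _ _)
  · rw [hK z (not_le.1 hzK)]; simp

/-- Integration by parts in the momentum variable `p i`. -/
theorem integral_sub_mul_kern (hf : ContDiff ℝ (⊤ : ℕ∞) f) (hK : MomSupp K f) (hv : BddSupp v)
    (hu : BddSupp u) (i : Fin n) :
    ∫ z, f z * ((z.1.1 i - z.1.2 i : ℝ) : ℂ) * kern v u z =
      Complex.I * bil (dd (dir (Sum.inr i)) f) v u := by
  have hint1 : Integrable fun z => f z * ((z.1.1 i - z.1.2 i : ℝ) : ℂ) * kern v u z :=
    integrable_mul_kern_of_continuous (K := K) (hf.continuous.mul (by fun_prop)) hv hu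
      fun z hz => by rw [hK z hz, zero_mul]
  have hint2 : Integrable fun z => dd (dir (Sum.inr i)) f z * kern v u z :=
    integrable_mul_kern_of_continuous (hf.dd _).continuous hv hu (hK.dd _)
  rw [bil, Measure.volume_eq_prod, integral_prod _ hint1, integral_prod _ hint2,
    ← integral_const_mul]
  refine integral_congr_ae (Filter.Eventually.of_forall fun xy => ?_)
  obtain ⟨x, y⟩ := xy
  dsimp only
  set g : Vec n → ℂ := fun p => kern v u ((x, y), p) with hg
  set φ : Vec n → ℂ := fun p => f ((x, y), p) with hφ
  have hφs : ContDiff ℝ (⊤ : ℕ∞) φ := hf.comp (contDiff_const.prodMk contDiff_id)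
  have hφd : ∀ p, fderiv ℝ φ p (Pi.single i 1) = dd (dir (Sum.inr i)) f ((x, y), p) := by
    intro p
    have h1 : HasFDerivAt (fun p : Vec n => ((x, y), p))
        (ContinuousLinearMap.inr ℝ (Vec n × Vec n) (Vec n)) p := hasFDerivAt_prodMk_right _ _
    have h2 := ((hf.differentiable (by simp)) ((x, y), p)).hasFDerivAt.comp p h1
    rw [show φ = f ∘ fun p : Vec n => ((x, y), p) from rfl, h2.fderiv]
    rfl
  have hgd : ∀ p, HasFDerivAt g ((Complex.I * g p) •
      (Complex.ofRealCLM.comp (∑ j, (x j - y j) • ContinuousLinearMap.proj (R := ℝ)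
        (φ := fun _ : Fin n => ℝ) j))) p := by
    intro p
    have e : g = fun p => Complex.exp (Complex.I * (((∑ j, (x j - y j) •
        ContinuousLinearMap.proj (R := ℝ) (φ := fun _ : Fin n => ℝ) j) p : ℝ) : ℂ)) *
          (v x * u y) := by
      ext p
      have : osc p x * osc (-p) y = Complex.exp (Complex.I * (((∑ j, (x j - y j) •
        ContinuousLinearMap.proj (R := ℝ) (φ := fun _ : Fin n => ℝ) j) p : ℝ) : ℂ)) := by
        rw [← phase_eq_osc_mul, phase]
        simp [mul_comm]
      rw [← this, hg]
      simp only [kern]; ring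
    have h1 := ((Complex.ofRealCLM.comp (∑ j, (x j - y j) • ContinuousLinearMap.proj (R := ℝ)
        (φ := fun _ : Fin n => ℝ) j)).hasFDerivAt (x := p))
    have h2 := ((h1.const_mul Complex.I).cexp).mul_const (v x * u y)
    rw [e]
    refine h2.congr_fderiv ?_
    ext q
    simp
    ring
  have hgd' : ∀ p, fderiv ℝ g p (Pi.single i 1) = Complex.I * g p * ((x i - y i : ℝ) : ℂ) := by
    intro p
    rw [(hgd p).fderiv]
    simp [Pi.single_apply]
  have hgdiff : Differentiable ℝ g := fun p => (hgd p).differentiableAt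
  have hcs : HasCompactSupport φ := by
    refine HasCompactSupport.intro (isCompact_closedBall (0 : Vec n) K) fun p hp => hK _ ?_
    simpa using hp
  have hcs' : HasCompactSupport fun p => fderiv ℝ φ p (Pi.single i 1) := hcs.fderiv_apply ℝ _
  have hcd : Continuous fun p => fderiv ℝ φ p (Pi.single i 1) :=
    (hφs.continuous_fderiv (by simp)).clm_apply continuous_const
  have key := integral_mul_fderiv_eq_neg_fderiv_mul_of_integrable (μ := volume) (f := φ) (g := g)
    (v := Pi.single i 1)
    ((hcd.mul hgdiff.continuous).integrable_of_hasCompactSupport hcs'.mul_right)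
    (by
      simp only [hgd']
      exact (hφs.continuous.mul (((continuous_const.mul hgdiff.continuous).mul
        continuous_const))).integrable_of_hasCompactSupport hcs.mul_right)
    ((hφs.continuous.mul hgdiff.continuous).integrable_of_hasCompactSupport hcs.mul_right)
    (fun p _ => (hφs.differentiable (by simp)) p) (fun p _ => hgdiff p)
  simp only [hgd', hφd] at key
  have e2 : ∀ p, φ p * (Complex.I * g p * ((x i - y i : ℝ) : ℂ)) =
      Complex.I * (φ p * ((x i - y i : ℝ) : ℂ) * g p) := fun p => by ring
  simp only [e2, integral_const_mul] at key
  rw [← neg_eq_iff_eq_neg, ← neg_mul] at key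
  rw [← key, ← mul_assoc]
  simp [hφ, hg]

theorem norm_cornerMultiplier_le {c η s : ℝ} (hη : 0 < η) (hs : s ∈ Set.Icc c (c + η)) :
    ‖(((s - c) / η : ℝ) : ℂ)‖ ≤ 1 := by
  rw [Complex.norm_real, Real.norm_eq_abs, abs_of_nonneg (div_nonneg (by linarith [hs.1]) hη.le),
    div_le_one hη]
  linarith [hs.2]

/-- Decay of the bilinear form in the distance of the two boxes. -/
theorem prod_mul_norm_bil_le (hh : ∀ i, 0 < h i) (w : List (Fin n)) :
    ∀ {M : ℕ} {D : ℝ} {f : PS n → ℂ} {v u : Vec n → ℂ}, 2 * n + w.length ≤ M →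
    ContDiff ℝ (⊤ : ℕ∞) f → SymBound h (box b h) M D f → MomSupp K f → BddSupp v → BddSupp u →
    SuppIn (fun i => b (Sum.inl i)) h v → SuppIn (fun i => b (Sum.inr i)) h u →
    (w.map fun i => 1 + |b (Sum.inl i) - b (Sum.inr i)| / h i).prod * ‖bil f v u‖ ≤
      4 ^ w.length * (4 ^ n * (2 * π) ^ n * D * L2 v * L2 u) := by
  induction w with
  | nil =>
    intro M D f v u hM hf hS hK hv hu hvs hus
    simpa using norm_bil_le hh (by simpa using hM) hf hS hK hv hu hvs hus
  | cons i w ih =>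
    intro M D f v u hM hf hS hK hv hu hvs hus
    obtain ⟨M, rfl⟩ : ∃ M', M = M' + 1 := ⟨M - 1, by simp at hM; omega⟩
    have hM' : 2 * n + w.length ≤ M := by simp at hM; omega
    have hi := hh i
    have hD0 : 0 ≤ D := (norm_nonneg _).trans (hS.norm_le (corner_mem_box hh 0))
    set P := (w.map fun i => 1 + |b (Sum.inl i) - b (Sum.inr i)| / h i).prod
    have hP : 0 ≤ P := by
      refine List.prod_nonneg ?_
      simp only [List.mem_map]
      rintro _ ⟨j, _, rfl⟩
      have := hh j
      positivity
    set X := 4 ^ w.length * (4 ^ n * (2 * π) ^ n * D * L2 v * L2 u) with hX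
    have hS' := hS.mono subset_rfl (Nat.le_succ M) le_rfl
    set mv : Vec n → ℂ := fun x => (((x i - b (Sum.inl i)) / h i : ℝ) : ℂ) with hmv
    set mu : Vec n → ℂ := fun y => (((y i - b (Sum.inr i)) / h i : ℝ) : ℂ) with hmu
    have hmvm : Measurable mv := (by rw [hmv]; fun_prop : Continuous mv).measurable
    have hmum : Measurable mu := (by rw [hmu]; fun_prop : Continuous mu).measurable
    have hmv1 : ∀ x, v x ≠ 0 → ‖mv x‖ ≤ 1 := fun x hx => norm_cornerMultiplier_le hi (hvs x hx i)
    have hmu1 : ∀ x, u x ≠ 0 → ‖mu x‖ ≤ 1 := fun x hx => norm_cornerMultiplier_le hi (hus x hx i)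
    have hv' := hv.mul_bdd hmvm hmv1
    have hu' := hu.mul_bdd hmum hmu1
    have hle : ∀ {m a : Vec n → ℂ}, (∀ x, a x ≠ 0 → ‖m x‖ ≤ 1) → ∀ x, ‖m x * a x‖ ≤ ‖a x‖ := by
      intro m a hm x
      by_cases hx : a x = 0
      · simp [hx]
      · rw [norm_mul]; exact mul_le_of_le_one_left (norm_nonneg _) (hm x hx)
    have hLv := hv.L2_mono (hle hmv1)
    have hLu := hu.L2_mono (hle hmu1)
    have h0 : P * ‖bil f v u‖ ≤ X := ih hM' hf hS' hK hv hu hvs hus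
    have h1 : P * ‖bil (dd (dir (Sum.inr i)) f) v u‖ ≤ h i * X := by
      refine (ih hM' (hf.dd _) (hS.dd hh _) (hK.dd _) hv hu hvs hus).trans (le_of_eq ?_)
      simp only [wt, div_inv_eq_mul, hX]; ring
    have := L2_nonneg v
    have := L2_nonneg u
    have := L2_nonneg (fun x => mu x * u x)
    have h2 : P * ‖bil f (fun x => mv x * v x) u‖ ≤ X := by
      refine (ih hM' hf hS' hK hv' hu (fun x hx => hvs x (right_ne_zero_of_mul hx)) hus).trans ?_
      rw [hX]; gcongr
    have h3 : P * ‖bil f v (fun x => mu x * u x)‖ ≤ X := by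
      refine (ih hM' hf hS' hK hv hu' hvs (fun x hx => hus x (right_ne_zero_of_mul hx))).trans ?_
      rw [hX]; gcongr
    set d := b (Sum.inl i) - b (Sum.inr i) with hd
    have hint : ∀ {a c : Vec n → ℂ}, BddSupp a → BddSupp c →
        Integrable fun z => f z * kern a c z :=
      fun ha hc => integrable_mul_kern_of_continuous hf.continuous ha hc hK
    have hint1 : Integrable fun z => f z * ((z.1.1 i - z.1.2 i : ℝ) : ℂ) * kern v u z :=
      integrable_mul_kern_of_continuous (K := K) (hf.continuous.mul (by fun_prop)) hv hu
        fun z hz => by rw [hK z hz, zero_mul]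
    have key : ((d / h i : ℝ) : ℂ) * bil f v u =
        ((h i)⁻¹ : ℝ) * (Complex.I * bil (dd (dir (Sum.inr i)) f) v u) -
          bil f (fun x => mv x * v x) u + bil f v (fun x => mu x * u x) := by
      rw [← integral_sub_mul_kern hf hK hv hu i]
      simp only [bil]
      have hI : Integrable fun z =>
          ((h i)⁻¹ : ℝ) * (f z * ((z.1.1 i - z.1.2 i : ℝ) : ℂ) * kern v u z) -
            f z * kern (fun x => mv x * v x) u z := (hint1.const_mul _).sub (hint hv' hu)
      rw [← integral_const_mul, ← integral_const_mul, ← integral_sub (hint1.const_mul _)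
        (hint hv' hu), ← integral_add hI (hint hv hu')]
      refine integral_congr_ae (Filter.Eventually.of_forall fun z => ?_)
      have : (h i : ℂ) ≠ 0 := by exact_mod_cast hi.ne'
      simp only [kern, hmv, hmu, hd]
      push_cast
      field_simp
      ring
    have h4 : |d| / h i * ‖bil f v u‖ ≤ (h i)⁻¹ * ‖bil (dd (dir (Sum.inr i)) f) v u‖ +
        ‖bil f (fun x => mv x * v x) u‖ + ‖bil f v (fun x => mu x * u x)‖ := by
      have e : |d| / h i * ‖bil f v u‖ = ‖((d / h i : ℝ) : ℂ) * bil f v u‖ := by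
        rw [norm_mul, Complex.norm_real, Real.norm_eq_abs, abs_div, abs_of_pos hi]
      rw [e, key]
      refine (norm_add_le _ _).trans (add_le_add_left ((norm_sub_le _ _).trans
        (add_le_add_left (le_of_eq ?_) _)) _)
      rw [norm_mul, norm_mul, Complex.norm_I, one_mul, Complex.norm_real, Real.norm_eq_abs,
        abs_of_pos (inv_pos.2 hi)]
    rw [List.map_cons, List.prod_cons, List.length_cons]
    calc _ = P * ‖bil f v u‖ + P * (|d| / h i * ‖bil f v u‖) := by ring
      _ ≤ X + P * ((h i)⁻¹ * ‖bil (dd (dir (Sum.inr i)) f) v u‖ +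
        ‖bil f (fun x => mv x * v x) u‖ + ‖bil f v (fun x => mu x * u x)‖) := by gcongr
      _ = X + ((h i)⁻¹ * (P * ‖bil (dd (dir (Sum.inr i)) f) v u‖) +
        P * ‖bil f (fun x => mv x * v x) u‖ + P * ‖bil f v (fun x => mu x * u x)‖) := by ring
      _ ≤ X + ((h i)⁻¹ * (h i * X) + X + X) := by gcongr
      _ = 4 ^ (w.length + 1) * (4 ^ n * (2 * π) ^ n * D * L2 v * L2 u) := by
        rw [hX]; field_simp; ring

end Decay

noncomputable section

/-- The cell of the grid with origin `β` and mesh `h` containing `x`. -/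
def cell {n : ℕ} (β h : Fin n → ℝ) (x : Vec n) : Fin n → ℤ := fun i => ⌊(x i - β i) / h i⌋

/-- The restriction of `v` to the cell `l`. -/
def piece {n : ℕ} (β h : Fin n → ℝ) (v : Vec n → ℂ) (l : Fin n → ℤ) : Vec n → ℂ :=
  fun x => if cell β h x = l then v x else 0

/-- The constant of the Schur test. -/
def schurConst : ℝ := ∑' m : ℤ, ((1 + |(m : ℝ)|) ^ 2)⁻¹

end

section Schur

variable {n : ℕ} {h : Fin n → ℝ} {M : ℕ} {D K : ℝ} {f : PS n → ℂ} {u v : Vec n → ℂ}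

theorem summable_schur : Summable fun m : ℤ => ((1 + |(m : ℝ)|) ^ 2)⁻¹ := by
  have h1 : Summable fun m : ℕ => ((1 + |(m : ℝ)|) ^ 2)⁻¹ := by
    refine ((summable_nat_add_iff 1).2 (Real.summable_nat_pow_inv.2 one_lt_two)).congr fun m => ?_
    simp [add_comm]
  refine Summable.of_nat_of_neg (by simpa using h1) (by simpa using h1)

theorem schurConst_nonneg : 0 ≤ schurConst := tsum_nonneg fun _ => by positivity

theorem sum_schur_le (s : Finset ℤ) (c : ℤ) :
    ∑ m ∈ s, ((1 + |((m - c : ℤ) : ℝ)|) ^ 2)⁻¹ ≤ schurConst := by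
  have h1 : Summable fun m : ℤ => ((1 + |((m - c : ℤ) : ℝ)|) ^ 2)⁻¹ :=
    (Equiv.subRight c).summable_iff.2 summable_schur
  have h2 : ∑' m : ℤ, ((1 + |((m - c : ℤ) : ℝ)|) ^ 2)⁻¹ = schurConst :=
    (Equiv.subRight c).tsum_eq fun m : ℤ => ((1 + |(m : ℝ)|) ^ 2)⁻¹
  rw [← h2]
  exact h1.sum_le_tsum _ fun _ _ => by positivity

theorem sum_prod_schur_le (s : Fin n → Finset ℤ) (c : Fin n → ℤ) :
    ∑ l ∈ Fintype.piFinset s, ∏ i, ((1 + |((l i - c i : ℤ) : ℝ)|) ^ 2)⁻¹ ≤ schurConst ^ n := by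
  rw [← Finset.prod_univ_sum s fun i m => ((1 + |((m - c i : ℤ) : ℝ)|) ^ 2)⁻¹]
  refine (Finset.prod_le_prod (fun i _ => Finset.sum_nonneg fun _ _ => by positivity)
    fun i _ => sum_schur_le (s i) (c i)).trans (le_of_eq ?_)
  simp

/-- The Schur test for finite nonnegative kernels. -/
theorem schur_test {ι κ : Type*} (s : Finset ι) (t : Finset κ) {k : ι → κ → ℝ} {a : ι → ℝ}
    {c : κ → ℝ} {S : ℝ} (hk : ∀ x y, 0 ≤ k x y) (hS : 0 ≤ S)
    (h1 : ∀ x ∈ s, ∑ y ∈ t, k x y ≤ S) (h2 : ∀ y ∈ t, ∑ x ∈ s, k x y ≤ S) :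
    ∑ x ∈ s, ∑ y ∈ t, k x y * (a x * c y) ≤
      S * √(∑ x ∈ s, a x ^ 2) * √(∑ y ∈ t, c y ^ 2) := by
  have e1 : ∑ p ∈ s ×ˢ t, (√(k p.1 p.2) * a p.1) ^ 2 ≤ S * ∑ x ∈ s, a x ^ 2 := by
    rw [Finset.sum_product, Finset.mul_sum]
    refine Finset.sum_le_sum fun x hx => ?_
    simp only [mul_pow, Real.sq_sqrt (hk _ _)]
    rw [← Finset.sum_mul]
    exact mul_le_mul_of_nonneg_right (h1 x hx) (sq_nonneg _)
  have e2 : ∑ p ∈ s ×ˢ t, (√(k p.1 p.2) * c p.2) ^ 2 ≤ S * ∑ y ∈ t, c y ^ 2 := by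
    rw [Finset.sum_product_right, Finset.mul_sum]
    refine Finset.sum_le_sum fun y hy => ?_
    simp only [mul_pow, Real.sq_sqrt (hk _ _)]
    rw [← Finset.sum_mul]
    exact mul_le_mul_of_nonneg_right (h2 y hy) (sq_nonneg _)
  calc _ = ∑ p ∈ s ×ˢ t, (√(k p.1 p.2) * a p.1) * (√(k p.1 p.2) * c p.2) := by
        rw [Finset.sum_product]
        refine Finset.sum_congr rfl fun x _ => Finset.sum_congr rfl fun y _ => ?_
        calc _ = (√(k x y) * √(k x y)) * (a x * c y) := by rw [Real.mul_self_sqrt (hk _ _)]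
          _ = _ := by ring
    _ ≤ √(∑ p ∈ s ×ˢ t, (√(k p.1 p.2) * a p.1) ^ 2) *
        √(∑ p ∈ s ×ˢ t, (√(k p.1 p.2) * c p.2) ^ 2) := Real.sum_mul_le_sqrt_mul_sqrt _ _ _
    _ ≤ √(S * ∑ x ∈ s, a x ^ 2) * √(S * ∑ y ∈ t, c y ^ 2) := by gcongr
    _ = (√S * √S) * √(∑ x ∈ s, a x ^ 2) * √(∑ y ∈ t, c y ^ 2) := by
        rw [Real.sqrt_mul hS, Real.sqrt_mul hS]; ring
    _ = _ := by rw [Real.mul_self_sqrt hS]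

theorem BddSupp.piece (hv : BddSupp v) (β h : Fin n → ℝ) (l : Fin n → ℤ) :
    BddSupp (piece β h v l) := by
  have hm : Measurable (cell β h) := by
    refine measurable_pi_iff.2 fun i => Int.measurable_floor.comp ?_
    exact ((measurable_pi_apply i).sub_const _).div_const _
  have := hv.mul_bdd (w := fun x => if cell β h x = l then 1 else 0)
    (Measurable.ite (hm (measurableSet_singleton l)) measurable_const measurable_const)
    (fun x _ => by split_ifs <;> simp)
  simp only [ite_mul, one_mul, zero_mul] at this
  exact this

theorem suppIn_piece (hh : ∀ i, 0 < h i) (β : Fin n → ℝ) (v : Vec n → ℂ) (l : Fin n → ℤ) :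
    SuppIn (fun i => β i + h i * l i) h (piece β h v l) := by
  intro x hx i
  have hl : cell β h x = l := by
    by_contra hne
    simp [piece, hne] at hx
  have hi := hh i
  subst hl
  have h1 := Int.floor_le ((x i - β i) / h i)
  have h2 := (Int.lt_floor_add_one ((x i - β i) / h i)).le
  rw [le_div_iff₀ hi] at h1
  rw [div_le_iff₀ hi] at h2
  simp only [cell]
  constructor <;> linarith

theorem sum_piece (β h : Fin n → ℝ) {F : Finset (Fin n → ℤ)} {x : Vec n}
    (hF : v x ≠ 0 → cell β h x ∈ F) : ∑ l ∈ F, piece β h v l x = v x := by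
  simp only [piece, Finset.sum_ite_eq]
  by_cases hx : v x = 0
  · simp [hx]
  · simp [hF hx]

theorem sum_L2_piece_sq (hv : BddSupp v) (β h : Fin n → ℝ) {F : Finset (Fin n → ℤ)}
    (hF : ∀ x, v x ≠ 0 → cell β h x ∈ F) : √(∑ l ∈ F, L2 (piece β h v l) ^ 2) = L2 v := by
  simp only [L2_sq]
  rw [← integral_finsetSum _ fun l _ => (hv.piece β h l).integrable_sq, L2]
  congr 2
  ext x
  have : ∀ l, ‖piece β h v l x‖ ^ 2 = if cell β h x = l then ‖v x‖ ^ 2 else 0 := by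
    intro l; simp only [piece]; split_ifs <;> simp
  simp only [this, Finset.sum_ite_eq]
  by_cases hx : v x = 0
  · simp [hx]
  · simp [hF x hx]

theorem bil_eq_sum (hf : Continuous f) (hK : MomSupp K f) (hv : BddSupp v) (hu : BddSupp u)
    (β β' h : Fin n → ℝ) {F F' : Finset (Fin n → ℤ)} (hF : ∀ x, v x ≠ 0 → cell β h x ∈ F)
    (hF' : ∀ x, u x ≠ 0 → cell β' h x ∈ F') :
    bil f v u = ∑ l ∈ F, ∑ l' ∈ F', bil f (piece β h v l) (piece β' h u l') := by
  have hint : ∀ l l', Integrable fun z => f z * kern (piece β h v l) (piece β' h u l') z :=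
    fun l l' => integrable_mul_kern_of_continuous hf (hv.piece _ _ _) (hu.piece _ _ _) hK
  simp only [bil]
  simp_rw [← integral_finsetSum F' fun l' _ => hint _ l']
  rw [← integral_finsetSum F fun l _ => integrable_finsetSum F' fun l' _ => hint l l']
  refine integral_congr_ae (Filter.Eventually.of_forall fun z => ?_)
  simp only [kern]
  simp_rw [← Finset.mul_sum]
  simp_rw [sum_piece _ _ (hF' _), ← Finset.sum_mul, ← Finset.mul_sum, sum_piece _ _ (hF _)]

theorem BddSupp.exists_cells [NeZero n] (hv : BddSupp v) {j : ℝ} (h0 : h 0 = 2)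
    (hj : ∀ x, v x ≠ 0 → |x 0 - j| < 1) :
    ∃ s : Fin n → Finset ℤ, s 0 = {0} ∧
      ∀ x, v x ≠ 0 → cell (Pi.single 0 (j - 1)) h x ∈ Fintype.piFinset s := by
  obtain ⟨r, hr⟩ := hv.supp
  refine ⟨fun i => if i = 0 then {0} else Finset.Icc (-⌈r / |h i|⌉) ⌈r / |h i|⌉, by simp,
    fun x hx => Fintype.mem_piFinset.2 fun i => ?_⟩
  by_cases hi : i = 0
  · subst hi
    have := abs_lt.1 (hj x hx)
    simp only [if_true, Finset.mem_singleton, cell, Pi.single_eq_same, h0, Int.floor_eq_zero_iff,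
      Set.mem_Ico]
    constructor
    · linarith
    · rw [div_lt_one (by norm_num)]; linarith
  · simp only [hi, if_false, cell, Pi.single_eq_of_ne hi, sub_zero, Finset.mem_Icc]
    have h1 : |x i / h i| ≤ r / |h i| := by
      rw [abs_div]
      exact div_le_div_of_nonneg_right ((norm_le_pi_norm x i).trans (hr x hx)) (abs_nonneg _)
    have h2 := abs_le.1 (h1.trans (Int.le_ceil _))
    refine ⟨Int.le_floor.2 (by push_cast; exact h2.1), ?_⟩
    exact_mod_cast (Int.floor_le _).trans h2.2

/-- The bilinear form localised to two strips is bounded, with decay in their distance. -/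
theorem pow_mul_norm_bil_le [NeZero n] (hh : ∀ i, 0 < h i) (h0 : h 0 = 2) (N : ℕ) {j k : ℝ}
    (hM : 2 * n + (N + 2 * n) ≤ M) (hf : ContDiff ℝ (⊤ : ℕ∞) f)
    (hS : SymBound h {z | |z.1.1 0 - j| ≤ 1 ∧ |z.1.2 0 - k| ≤ 1} M D f) (hK : MomSupp K f)
    (hv : BddSupp v) (hu : BddSupp u) (hvj : ∀ x, v x ≠ 0 → |x 0 - j| < 1)
    (huk : ∀ x, u x ≠ 0 → |x 0 - k| < 1) :
    (1 + |j - k| / 2) ^ N * ‖bil f v u‖ ≤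
      4 ^ (N + 2 * n) * (4 ^ n * (2 * π) ^ n) * schurConst ^ n * D * L2 v * L2 u := by
  set β : Fin n → ℝ := Pi.single 0 (j - 1) with hβ
  set β' : Fin n → ℝ := Pi.single 0 (k - 1) with hβ'
  obtain ⟨s, hs0, hs⟩ := hv.exists_cells h0 hvj
  obtain ⟨s', hs0', hs'⟩ := hu.exists_cells h0 huk
  set P := (1 + |j - k| / 2) ^ N with hP
  set X := 4 ^ (N + 2 * n) * (4 ^ n * (2 * π) ^ n) with hX
  set κ : (Fin n → ℤ) → (Fin n → ℤ) → ℝ := fun l l' =>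
    ∏ i, ((1 + |((l i - l' i : ℤ) : ℝ)|) ^ 2)⁻¹ with hκ
  have hκ0 : ∀ l l', 0 ≤ κ l l' := fun l l' => Finset.prod_nonneg fun _ _ => by positivity
  have hD0 : 0 ≤ D := by
    refine (norm_nonneg _).trans (hS.norm_le (z := ((fun _ => j, fun _ => k), 0)) ?_)
    simp
  have main : ∀ l ∈ Fintype.piFinset s, ∀ l' ∈ Fintype.piFinset s',
      P * ‖bil f (piece β h v l) (piece β' h u l')‖ ≤
        X * D * (κ l l' * (L2 (piece β h v l) * L2 (piece β' h u l'))) := by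
    intro l hl l' hl'
    have hl0 : l 0 = 0 := by simpa [hs0] using Fintype.mem_piFinset.1 hl 0
    have hl0' : l' 0 = 0 := by simpa [hs0'] using Fintype.mem_piFinset.1 hl' 0
    set b : Slot n → ℝ := Sum.elim (fun i => β i + h i * l i) (fun i => β' i + h i * l' i) with hb
    have hbox : box b h ⊆ {z | |z.1.1 0 - j| ≤ 1 ∧ |z.1.2 0 - k| ≤ 1} := by
      intro z hz
      have h1 := hz (Sum.inl 0)
      have h2 := hz (Sum.inr 0)
      simp only [coord_inl, coord_inr, hb, Sum.elim_inl, Sum.elim_inr, hβ, hβ', Pi.single_eq_same,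
        hl0, hl0', wt, h0, Set.mem_Icc] at h1 h2
      constructor <;> rw [abs_le] <;> constructor <;> push_cast at h1 h2 <;> linarith [h1.1, h1.2]
    have key := prod_mul_norm_bil_le hh (List.replicate N 0 ++ (List.finRange n ++ List.finRange n))
      (b := b) (M := M) (by simpa [two_mul] using hM) hf (hS.mono hbox le_rfl le_rfl) hK
      (hv.piece β h l) (hu.piece β' h l') (suppIn_piece hh β v l) (suppIn_piece hh β' u l')
    simp only [List.map_append, List.prod_append, List.map_replicate, List.prod_replicate,
      List.length_append, List.length_replicate, List.length_finRange, ← Fin.prod_univ_def] at key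
    have e0 : |b (Sum.inl 0) - b (Sum.inr 0)| / h 0 = |j - k| / 2 := by
      simp [hb, hβ, hβ', hl0, hl0', h0]
    rw [e0, ← hP, ← Finset.prod_mul_distrib, ← two_mul] at key
    have e1 : ∀ i, |((l i - l' i : ℤ) : ℝ)| ≤ |b (Sum.inl i) - b (Sum.inr i)| / h i := by
      intro i
      by_cases hi : i = 0
      · subst hi
        rw [e0, hl0, hl0']; simp; positivity
      · rw [le_div_iff₀ (hh i)]
        simp only [hb, Sum.elim_inl, Sum.elim_inr, hβ, hβ', Pi.single_eq_of_ne hi]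
        rw [← abs_of_pos (hh i), ← abs_mul, abs_of_pos (hh i)]
        refine le_of_eq (congrArg _ ?_)
        push_cast; ring
    have e2 : (κ l l')⁻¹ ≤ ∏ i, (1 + |b (Sum.inl i) - b (Sum.inr i)| / h i) *
        (1 + |b (Sum.inl i) - b (Sum.inr i)| / h i) := by
      rw [hκ]
      dsimp only
      rw [← Finset.prod_inv_distrib]
      refine Finset.prod_le_prod (fun i _ => by positivity) fun i _ => ?_
      rw [inv_inv, ← sq]
      gcongr
      exact e1 i
    have hκpos : 0 < κ l l' := Finset.prod_pos fun _ _ => by positivity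
    have hP0 : 0 ≤ P := by positivity
    have : P * (κ l l')⁻¹ * ‖bil f (piece β h v l) (piece β' h u l')‖ ≤
        4 ^ (N + 2 * n) * (4 ^ n * (2 * π) ^ n * D * L2 (piece β h v l) * L2 (piece β' h u l')) :=
      (by gcongr : _ ≤ _).trans key
    calc _ = κ l l' * (P * (κ l l')⁻¹ * ‖bil f (piece β h v l) (piece β' h u l')‖) := by
          field_simp
      _ ≤ κ l l' * (4 ^ (N + 2 * n) *
          (4 ^ n * (2 * π) ^ n * D * L2 (piece β h v l) * L2 (piece β' h u l'))) := by gcongr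
      _ = _ := by rw [hX]; ring
  have hsch := schur_test (Fintype.piFinset s) (Fintype.piFinset s') (k := κ)
    (a := fun l => L2 (piece β h v l)) (c := fun l' => L2 (piece β' h u l'))
    (S := schurConst ^ n) hκ0 (pow_nonneg schurConst_nonneg n)
    (fun l _ => by
      refine (le_of_eq (Finset.sum_congr rfl fun l' _ => ?_)).trans (sum_prod_schur_le s' l)
      simp only [hκ]
      refine Finset.prod_congr rfl fun i _ => ?_
      push_cast
      rw [abs_sub_comm])
    (fun l' _ => sum_prod_schur_le s l')
  rw [sum_L2_piece_sq hv β h hs, sum_L2_piece_sq hu β' h hs'] at hsch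
  calc _ ≤ P * ∑ l ∈ Fintype.piFinset s, ∑ l' ∈ Fintype.piFinset s',
        ‖bil f (piece β h v l) (piece β' h u l')‖ := by
        rw [bil_eq_sum hf.continuous hK hv hu β β' h hs hs']
        gcongr
        exact (norm_sum_le _ _).trans (Finset.sum_le_sum fun l _ => norm_sum_le _ _)
    _ ≤ X * D * ∑ l ∈ Fintype.piFinset s, ∑ l' ∈ Fintype.piFinset s',
        κ l l' * (L2 (piece β h v l) * L2 (piece β' h u l')) := by
        simp_rw [Finset.mul_sum]
        exact Finset.sum_le_sum fun l hl => Finset.sum_le_sum fun l' hl' => main l hl l' hl'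
    _ ≤ X * D * (schurConst ^ n * L2 v * L2 u) := by gcongr
    _ = _ := by rw [hX]; ring

end Schur

noncomputable section

/-- The list of indices in which `i` occurs `A i` times. -/
def idx {n : ℕ} (A : Fin n → ℕ) : List (Fin n) :=
  (List.finRange n).flatMap fun i => List.replicate (A i) i

/-- The list of directions encoding the mixed derivative `∂_q^A ∂_p^B ∂_{q'}^{A'}`. -/
def dirList {n : ℕ} (A B A' : Fin n → ℕ) : List (Dir n) :=
  (idx A).map (fun i => Sum.inl (Sum.inl i)) ++ ((idx B).map Sum.inr ++
    (idx A').map fun i => Sum.inl (Sum.inr i))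

end

section Derivatives

variable {n : ℕ}

theorem length_idx (A : Fin n → ℕ) : (idx A).length = fullLen A := by
  simp [idx, fullLen, List.length_flatMap, Fin.sum_univ_def]

theorem prod_map_idx (A : Fin n → ℕ) (w : Fin n → ℝ) :
    ((idx A).map w).prod = ∏ i, w i ^ A i := by
  rw [Fin.prod_univ_def, idx]
  induction List.finRange n with
  | nil => simp
  | cons i l ih => simp [ih]

theorem mpd_eq_ddL (A : Fin n → ℕ) (f : Vec n → ℂ) :
    mpd A f = ddL ((idx A).map fun i => Pi.single i 1) f := by
  have h1 : ∀ (k : ℕ) (i : Fin n) (g : Vec n → ℂ),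
      (pdC i)^[k] g = ddL (List.replicate k (Pi.single i 1)) g := by
    intro k i g
    induction k with
    | zero => rfl
    | succ k ih => rw [Function.iterate_succ_apply', ih]; rfl
  rw [mpd, idx]
  induction List.finRange n with
  | nil => rfl
  | cons i l ih =>
    rw [List.foldr_cons, ih, h1, List.flatMap_cons, List.map_append, ddL_append,
      List.map_replicate]

theorem exists_perm_flatMap_replicate {α : Type*} [DecidableEq α] {E : List α} (hE : E.Nodup)
    (hL : ∀ x, x ∈ E) (L : List α) :
    ∃ c : α → ℕ, L.Perm (E.flatMap fun x => List.replicate (c x) x) := by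
  refine ⟨fun x => L.count x, ?_⟩
  rw [List.perm_iff_count]
  intro a
  rw [List.count_flatMap]
  have : ∀ E : List α, E.Nodup →
      (E.map (List.count a ∘ fun x => List.replicate (L.count x) x)).sum =
        if a ∈ E then L.count a else 0 := by
    intro E hE
    induction E with
    | nil => simp
    | cons x E ih =>
      rw [List.nodup_cons] at hE
      rw [List.map_cons, List.sum_cons, ih hE.2]
      by_cases hx : x = a
      · subst hx; simp [hE.1]
      · simp [hx, Ne.symm hx, List.count_replicate]
  rw [this E hE, if_pos (hL a)]

theorem exists_perm_dirList (L : List (Dir n)) : ∃ A B A', L.Perm (dirList A B A') := by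
  set E : List (Dir n) := (List.finRange n).map (fun i => Sum.inl (Sum.inl i)) ++
    ((List.finRange n).map Sum.inr ++ (List.finRange n).map fun i => Sum.inl (Sum.inr i)) with hE
  have h1 : E.Nodup := by
    simp only [hE, List.nodup_append]
    refine ⟨(List.nodup_finRange n).map fun _ _ h => by simpa using h,
      ⟨(List.nodup_finRange n).map fun _ _ h => by simpa using h,
      (List.nodup_finRange n).map fun _ _ h => by simpa using h, ?_⟩, ?_⟩ <;> simp
  have h2 : ∀ x, x ∈ E := by
    rintro ((i | i) | i) <;> simp [hE]
  obtain ⟨c, hc⟩ := exists_perm_flatMap_replicate h1 h2 L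
  refine ⟨fun i => c (Sum.inl (Sum.inl i)), fun i => c (Sum.inr i),
    fun i => c (Sum.inl (Sum.inr i)), hc.trans ?_⟩
  simp [hE, dirList, idx, List.flatMap_append, List.flatMap_map, List.map_flatMap]

theorem d1B_eq (A : Fin n → ℕ) {G : PS n → ℂ} (hG : ContDiff ℝ (⊤ : ℕ∞) G) :
    d1B A (fun q p q' => G ((q, q'), p)) = fun q p q' =>
      ddL ((idx A).map fun i => dir (Sum.inl (Sum.inl i))) G ((q, q'), p) := by
  ext q p q'
  have e : ∀ x : Vec n, ((x, q'), p) = ((ContinuousLinearMap.inl ℝ (Vec n × Vec n) (Vec n)).comp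
      (ContinuousLinearMap.inl ℝ (Vec n) (Vec n))) x + ((0, q'), p) := fun x => by simp
  change mpd A (fun x => G ((x, q'), p)) q = _
  rw [mpd_eq_ddL, show (fun x => G ((x, q'), p)) = _ from funext fun x => congrArg G (e x),
    ddL_comp_affine hG, List.map_map]
  exact congrArg _ (e q).symm

theorem d2B_eq (A : Fin n → ℕ) {G : PS n → ℂ} (hG : ContDiff ℝ (⊤ : ℕ∞) G) :
    d2B A (fun q p q' => G ((q, q'), p)) = fun q p q' =>
      ddL ((idx A).map fun i => dir (Sum.inr i)) G ((q, q'), p) := by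
  ext q p q'
  have e : ∀ x : Vec n, ((q, q'), x) = (ContinuousLinearMap.inr ℝ (Vec n × Vec n) (Vec n)) x +
      ((q, q'), 0) := fun x => by simp
  change mpd A (fun x => G ((q, q'), x)) p = _
  rw [mpd_eq_ddL, show (fun x => G ((q, q'), x)) = _ from funext fun x => congrArg G (e x),
    ddL_comp_affine hG, List.map_map]
  exact congrArg _ (e p).symm

theorem d3B_eq (A : Fin n → ℕ) {G : PS n → ℂ} (hG : ContDiff ℝ (⊤ : ℕ∞) G) :
    d3B A (fun q p q' => G ((q, q'), p)) = fun q p q' =>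
      ddL ((idx A).map fun i => dir (Sum.inl (Sum.inr i))) G ((q, q'), p) := by
  ext q p q'
  have e : ∀ x : Vec n, ((q, x), p) = ((ContinuousLinearMap.inl ℝ (Vec n × Vec n) (Vec n)).comp
      (ContinuousLinearMap.inr ℝ (Vec n) (Vec n))) x + ((q, 0), p) := fun x => by simp
  change mpd A (fun x => G ((q, x), p)) q' = _
  rw [mpd_eq_ddL, show (fun x => G ((q, x), p)) = _ from funext fun x => congrArg G (e x),
    ddL_comp_affine hG, List.map_map]
  exact congrArg _ (e q').symm

theorem mixed_eq_ddL (A B A' : Fin n → ℕ) {G : PS n → ℂ} (hG : ContDiff ℝ (⊤ : ℕ∞) G)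
    (q p q' : Vec n) : d1B A (d2B B (d3B A' fun q p q' => G ((q, q'), p))) q p q' =
      ddL ((dirList A B A').map dir) G ((q, q'), p) := by
  rw [d3B_eq A' hG, d2B_eq B (hG.ddL _), d1B_eq A ((hG.ddL _).ddL _)]
  simp [dirList, ddL_append, List.map_append, Function.comp_def]

theorem prod_wt_dirList [NeZero n] {μ : ℝ} (hμ : 0 < μ) (A B A' : Fin n → ℕ) :
    ((dirList A B A').map (wt fun i => if i = 0 then 1 else μ⁻¹)).prod =
      μ ^ ((angLen B : ℤ) - (angLen A : ℤ) - (angLen A' : ℤ)) := by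
  have h1 : ∀ (c : ℝ) (A : Fin n → ℕ), ((idx A).map fun i => if i = 0 then 1 else c).prod =
      c ^ angLen A := by
    intro c A
    rw [prod_map_idx, angLen, ← Finset.prod_pow_eq_pow_sum]
    refine Finset.prod_congr rfl fun i _ => ?_
    split_ifs <;> simp
  have h2 := h1 μ⁻¹ A
  have h3 := h1 μ B
  have h4 := h1 μ⁻¹ A'
  simp only [dirList, List.map_append, List.prod_append, List.map_map, Function.comp_def, wt,
    apply_ite (fun x : ℝ => x⁻¹), inv_one, inv_inv, h2, h3, h4]
  rw [zpow_sub₀ hμ.ne', zpow_sub₀ hμ.ne', zpow_natCast, zpow_natCast, zpow_natCast, inv_pow,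
    inv_pow]
  ring

theorem prod_wt_le [NeZero n] {μ : ℝ} (hμ : 0 < μ) (L : List (Dir n)) :
    (L.map (wt fun i => if i = 0 then 2 else μ⁻¹)).prod ≤
      2 ^ L.length * (L.map (wt fun i => if i = 0 then 1 else μ⁻¹)).prod := by
  have h1 : ∀ i : Fin n, 0 < if i = 0 then (1 : ℝ) else μ⁻¹ := fun i => by
    split_ifs <;> positivity
  have h2 : ∀ i : Fin n, 0 < if i = 0 then (2 : ℝ) else μ⁻¹ := fun i => by
    split_ifs <;> positivity
  induction L with
  | nil => simp
  | cons τ L ih =>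
    rw [List.map_cons, List.map_cons, List.prod_cons, List.prod_cons, List.length_cons]
    have h3 : wt (fun i : Fin n => if i = 0 then 2 else μ⁻¹) τ ≤
        2 * wt (fun i => if i = 0 then 1 else μ⁻¹) τ := by
      have := inv_pos.2 hμ
      have := inv_pos.2 this
      rcases τ with (i | i) | i <;> simp only [wt] <;> split_ifs <;> linarith
    have := (wt_prod_pos h2 L).le
    have := (wt_pos h1 τ).le
    calc _ ≤ (2 * wt (fun i => if i = 0 then 1 else μ⁻¹) τ) * (2 ^ L.length *
          (L.map (wt fun i => if i = 0 then 1 else μ⁻¹)).prod) := by gcongr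
      _ = _ := by ring

theorem le_iSup_of_bdd {ι : Type*} {G : ι → ℝ} {C : ℝ} (hC : ∀ i, G i ≤ C) (i : ι) :
    G i ≤ ⨆ i, G i :=
  le_ciSup ⟨C, by rintro _ ⟨i, rfl⟩; exact hC i⟩ i

theorem le_iSup_five {α β γ δ ε : Type*} {F : α → β → γ → δ → ε → ℝ} {C : ℝ}
    (h0 : ∀ a b c d e, 0 ≤ F a b c d e) (hC : ∀ a b c d e, F a b c d e ≤ C)
    (a : α) (b : β) (c : γ) (d : δ) (e : ε) :
    F a b c d e ≤ ⨆ a, ⨆ b, ⨆ c, ⨆ d, ⨆ e, F a b c d e := by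
  have hC0 : 0 ≤ C := (h0 a b c d e).trans (hC a b c d e)
  have b1 : ∀ a b c d, ⨆ e, F a b c d e ≤ C := fun a b c d => Real.iSup_le (hC a b c d) hC0
  have b2 : ∀ a b c, ⨆ d, ⨆ e, F a b c d e ≤ C := fun a b c => Real.iSup_le (b1 a b c) hC0
  have b3 : ∀ a b, ⨆ c, ⨆ d, ⨆ e, F a b c d e ≤ C := fun a b => Real.iSup_le (b2 a b) hC0
  have b4 : ∀ a, ⨆ b, ⨆ c, ⨆ d, ⨆ e, F a b c d e ≤ C := fun a => Real.iSup_le (b3 a) hC0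
  calc F a b c d e ≤ ⨆ e, F a b c d e := le_iSup_of_bdd (hC a b c d) e
    _ ≤ ⨆ d, ⨆ e, F a b c d e := le_iSup_of_bdd (b1 a b c) d
    _ ≤ ⨆ c, ⨆ d, ⨆ e, F a b c d e := le_iSup_of_bdd (b2 a b) c
    _ ≤ ⨆ b, ⨆ c, ⨆ d, ⨆ e, F a b c d e := le_iSup_of_bdd (b3 a) b
    _ ≤ _ := le_iSup_of_bdd b4 a

theorem le_bisymSeminorm [NeZero n] {lam : ℝ → ℝ} (hlam : ∀ r, 0 < lam r) {t : ℝ}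
    {a : Vec n → Vec n → Vec n → ℂ} (ha : IsBisymbol lam 0 0 t a) {M : ℕ} {A B A' : Fin n → ℕ}
    (hM : fullLen A + fullLen B + fullLen A' ≤ M) {j k : ℤ} {q q' : Vec n} (p : Vec n)
    (hq : |q 0 - (j : ℝ)| ≤ 1) (hq' : |q' 0 - (k : ℝ)| ≤ 1) :
    lamT lam t j k ^ ((angLen B : ℤ) - (angLen A : ℤ) - (angLen A' : ℤ)) *
        ‖d1B A (d2B B (d3B A' a)) q p q'‖ ≤ bisymSeminorm lam M 0 0 t a := by
  have hpos : ∀ j k, 0 < lamT lam t j k := fun j k => hlam _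
  have hlt : ∀ {A : Fin n → ℕ}, fullLen A ≤ M → ∀ i, A i < M + 1 := fun {A} hA i =>
    Nat.lt_succ_of_le ((Finset.single_le_sum (fun _ _ => Nat.zero_le _)
      (Finset.mem_univ i)).trans hA)
  obtain ⟨A, rfl⟩ : ∃ A₁ : Fin n → Fin (M + 1), A = fun i => (A₁ i : ℕ) :=
    ⟨fun i => ⟨A i, hlt (by omega) i⟩, rfl⟩
  obtain ⟨B, rfl⟩ : ∃ A₁ : Fin n → Fin (M + 1), B = fun i => (A₁ i : ℕ) :=
    ⟨fun i => ⟨B i, hlt (by omega) i⟩, rfl⟩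
  obtain ⟨A', rfl⟩ : ∃ A₁ : Fin n → Fin (M + 1), A' = fun i => (A₁ i : ℕ) :=
    ⟨fun i => ⟨A' i, hlt (by omega) i⟩, rfl⟩
  rw [bisymSeminorm]
  simp only [zero_mul, add_zero, neg_zero, Real.rpow_zero, one_mul]
  have hpz : ∀ (j k : ℤ) (m : ℤ), 0 ≤ lamT lam t j k ^ m := fun j k m => (zpow_pos (hpos j k) m).le
  have nn : ∀ A B A' : Fin n → Fin (M + 1), 0 ≤
      if fullLen (fun i => (A i : ℕ)) + fullLen (fun i => (B i : ℕ))
        + fullLen (fun i => (A' i : ℕ)) ≤ M then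
      ⨆ j : ℤ, ⨆ k : ℤ, ⨆ q : Vec n, ⨆ p : Vec n, ⨆ q' : Vec n,
        if |q 0 - (j : ℝ)| ≤ 1 ∧ |q' 0 - (k : ℝ)| ≤ 1 then
            (lamT lam t j k ^ ((angLen (fun i => (B i : ℕ)) : ℤ)
                - (angLen (fun i => (A i : ℕ)) : ℤ) - (angLen (fun i => (A' i : ℕ)) : ℤ)) *
              ‖d1B (fun i => (A i : ℕ)) (d2B (fun i => (B i : ℕ))
                  (d3B (fun i => (A' i : ℕ)) a)) q p q'‖)
        else 0
      else 0 := by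
    intro A B A'
    split_ifs
    · refine Real.iSup_nonneg fun j => Real.iSup_nonneg fun k => Real.iSup_nonneg fun q =>
        Real.iSup_nonneg fun p => Real.iSup_nonneg fun q' => ?_
      split_ifs
      · exact mul_nonneg (hpz _ _ _) (norm_nonneg _)
      · exact le_rfl
    · exact le_rfl
  refine le_trans ?_ (Finset.single_le_sum (fun A _ => Finset.sum_nonneg fun B _ =>
    Finset.sum_nonneg fun A' _ => nn A B A') (Finset.mem_univ A))
  refine le_trans ?_ (Finset.single_le_sum (fun B _ =>
    Finset.sum_nonneg fun A' _ => nn A B A') (Finset.mem_univ B))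
  refine le_trans ?_ (Finset.single_le_sum (fun A' _ => nn A B A') (Finset.mem_univ A'))
  rw [if_pos hM]
  obtain ⟨C, hC0, hC⟩ := ha.2 (fun i => (A i : ℕ)) (fun i => (B i : ℕ)) (fun i => (A' i : ℕ))
  simp only [zero_mul, sub_zero, Real.rpow_zero, mul_one] at hC
  refine le_trans (le_of_eq ?_) (le_iSup_five (C := C) (fun j k q p q' => ?_)
    (fun j k q p q' => ?_) j k q p q')
  · rw [if_pos ⟨hq, hq'⟩]
  · split_ifs
    · exact mul_nonneg (hpz _ _ _) (norm_nonneg _)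
    · exact le_rfl
  · split_ifs with hc
    · exact hC j k q p q' hc.1 hc.2
    · exact hC0.le

theorem contDiff_symbol [NeZero n] {lam : ℝ → ℝ} {t : ℝ} {a : Vec n → Vec n → Vec n → ℂ}
    (ha : IsBisymbol lam 0 0 t a) : ContDiff ℝ (⊤ : ℕ∞) fun z : PS n => a z.1.1 z.2 z.1.2 :=
  ha.1.comp (g := fun x : Vec n × Vec n × Vec n => a x.1 x.2.1 x.2.2)
    (f := fun z : PS n => (z.1.1, z.2, z.1.2)) (by fun_prop)

/-- The bisymbol estimates as scaled derivative bounds. -/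
theorem symBound_of_isBisymbol [NeZero n] {lam : ℝ → ℝ} (hlam : ∀ r, 0 < lam r) {t : ℝ}
    {a : Vec n → Vec n → Vec n → ℂ} (ha : IsBisymbol lam 0 0 t a) (M : ℕ) (j k : ℤ) :
    SymBound (fun i => if i = 0 then 2 else (lamT lam t j k)⁻¹)
      {z | |z.1.1 0 - (j : ℝ)| ≤ 1 ∧ |z.1.2 0 - (k : ℝ)| ≤ 1} M
      (2 ^ M * bisymSeminorm lam M 0 0 t a) (fun z => a z.1.1 z.2 z.1.2) := by
  intro L hL z hz
  have hμ : 0 < lamT lam t j k := hlam _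
  obtain ⟨A, B, A', hperm⟩ := exists_perm_dirList L
  have hlen : fullLen A + fullLen B + fullLen A' ≤ M := by
    have := hperm.length_eq
    simp only [dirList, List.length_append, List.length_map, length_idx] at this
    omega
  have h1 := le_bisymSeminorm hlam ha hlen z.2 hz.1 hz.2
  have h2 := mixed_eq_ddL A B A' (contDiff_symbol ha) z.1.1 z.2 z.1.2
  rw [h2, ← prod_wt_dirList hμ] at h1
  rw [ddL_perm (hperm.map dir) (contDiff_symbol ha)]
  have h3 : (L.map (wt fun i : Fin n => if i = 0 then 1 else (lamT lam t j k)⁻¹)).prod =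
      ((dirList A B A').map (wt fun i => if i = 0 then 1 else (lamT lam t j k)⁻¹)).prod :=
    (hperm.map _).prod_eq
  have h4 : ∀ i : Fin n, 0 < if i = 0 then (1 : ℝ) else (lamT lam t j k)⁻¹ := fun i => by
    split_ifs <;> positivity
  have h5 := (wt_prod_pos h4 L).le
  calc _ ≤ (2 ^ M * (L.map (wt fun i : Fin n => if i = 0 then 1 else (lamT lam t j k)⁻¹)).prod) *
        ‖ddL ((dirList A B A').map dir) (fun z : PS n => a z.1.1 z.2 z.1.2) z‖ := by
        gcongr
        refine (prod_wt_le hμ L).trans ?_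
        gcongr
        norm_num
    _ ≤ _ := by
        rw [mul_assoc, h3]
        gcongr

end Derivatives

noncomputable section

/-- A smooth cutoff function which equals `1` at the origin. -/
def cutoff {n : ℕ} (p : Vec n) : ℂ := ((default : ContDiffBump (0 : Vec n)) p : ℝ)

end

section Cutoff

variable {n : ℕ}

theorem contDiff_cutoff : ContDiff ℝ (⊤ : ℕ∞) (cutoff (n := n)) :=
  Complex.ofRealCLM.contDiff.comp (ContDiffBump.contDiff _)

theorem hasCompactSupport_cutoff : HasCompactSupport (cutoff (n := n)) :=
  (ContDiffBump.hasCompactSupport _).comp_left Complex.ofReal_zero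

theorem norm_cutoff_le (p : Vec n) : ‖cutoff p‖ ≤ 1 := by
  rw [cutoff, Complex.norm_real, Real.norm_of_nonneg (ContDiffBump.nonneg _)]
  exact ContDiffBump.le_one _

theorem cutoff_zero : cutoff (0 : Vec n) = 1 := by
  rw [cutoff, ContDiffBump.one_of_mem_closedBall _ (by simpa using (ContDiffBump.rIn_pos _).le)]
  simp

theorem cutoff_eq_zero {p : Vec n} (hp : 2 ≤ ‖p‖) : cutoff p = 0 := by
  rw [cutoff, ContDiffBump.zero_of_le_dist _ (by rw [dist_zero_right]; exact hp),
    Complex.ofReal_zero]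

theorem HasCompactSupport.ddL {E : Type*} [NormedAddCommGroup E] [NormedSpace ℝ E] {f : E → ℂ}
    (hf : HasCompactSupport f) (L : List E) : HasCompactSupport (ddL L f) := by
  induction L with
  | nil => exact hf
  | cons v L ih => exact ih.fderiv_apply ℝ v

theorem ddL_map_smul {E : Type*} [NormedAddCommGroup E] [NormedSpace ℝ E] (ε : ℝ) (L : List E)
    (f : E → ℂ) (hf : ContDiff ℝ (⊤ : ℕ∞) f) :
    ddL (L.map fun v => ε • v) f = fun z => (ε ^ L.length : ℝ) • ddL L f z := by
  induction L with
  | nil => simp [ddL]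
  | cons v L ih =>
    change dd (ε • v) (ddL (L.map fun v => ε • v) f) = fun z => _ • dd v (ddL L f) z
    rw [ih]
    ext z
    have : DifferentiableAt ℝ (ddL L f) z := (hf.ddL L).differentiable (by simp) z
    simp only [dd]
    rw [fderiv_fun_const_smul this]
    simp only [map_smul, FunLike.coe_smul, Pi.smul_apply, Complex.real_smul, List.length_cons]
    push_cast
    ring

theorem ddL_cutoff (ε : ℝ) (L : List (Dir n)) (z : PS n) :
    ddL (L.map dir) (fun z : PS n => cutoff (ε • z.2)) z =
      (ε ^ L.length : ℝ) • ddL (L.map fun τ => (dir τ).2) cutoff (ε • z.2) := by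
  have h := ddL_comp_affine contDiff_cutoff
    (ε • ContinuousLinearMap.snd ℝ (Vec n × Vec n) (Vec n)) 0 (L.map dir)
  simp only [add_zero, smul_apply, ContinuousLinearMap.coe_snd'] at h
  rw [h, List.map_map]
  have h2 := ddL_map_smul ε (L.map fun τ => (dir τ).2) _ (contDiff_cutoff (n := n))
  rw [List.map_map, List.length_map] at h2
  exact congrFun h2 _

/-- Slowly varying cutoffs in momentum have derivative bounds with constant `1`. -/
theorem eventually_symBound_cutoff {h : Fin n → ℝ} (hh : ∀ i, 0 < h i) (M : ℕ) :
    ∀ᶠ m : ℕ in Filter.atTop,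
      SymBound h Set.univ M 1 fun z : PS n => cutoff ((1 / ((m : ℝ) + 1)) • z.2) := by
  have key : ∀ L ∈ {L : List (Dir n) | L.length ≤ M}, ∀ᶠ m : ℕ in Filter.atTop, ∀ z : PS n,
      (L.map (wt h)).prod *
        ‖ddL (L.map dir) (fun z : PS n => cutoff ((1 / ((m : ℝ) + 1)) • z.2)) z‖ ≤ 1 := by
    intro L _
    obtain ⟨C, hC⟩ := (hasCompactSupport_cutoff.ddL
      (L.map fun τ : Dir n => (dir τ).2)).exists_bound_of_continuous
        (contDiff_cutoff.ddL _).continuous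
    have hP := wt_prod_pos hh L
    have hlim : Filter.Tendsto (fun m : ℕ => (L.map (wt h)).prod * ((1 / ((m : ℝ) + 1)) * C))
        Filter.atTop (nhds ((L.map (wt h)).prod * (0 * C))) :=
      (tendsto_one_div_add_atTop_nhds_zero_nat.mul_const C).const_mul _
    rw [zero_mul, mul_zero] at hlim
    filter_upwards [hlim.eventually_le_const one_pos] with m hm z
    rw [ddL_cutoff]
    rcases L with _ | ⟨τ, L⟩
    · simpa [ddL] using norm_cutoff_le _
    · refine le_trans ?_ hm
      have hε0 : 0 ≤ 1 / ((m : ℝ) + 1) := by positivity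
      have hε1 : 1 / ((m : ℝ) + 1) ≤ 1 := by
        rw [div_le_one (by positivity)]; linarith [Nat.cast_nonneg (α := ℝ) m]
      rw [norm_smul, Real.norm_of_nonneg (by positivity)]
      gcongr
      · rw [List.length_cons]
        exact pow_le_of_le_one hε0 hε1 (by simp)
      · exact hC _
  filter_upwards [(Filter.eventually_all_finite (List.finite_length_le (Dir n) M)).2 key] with
    m hm L hL z _ using hm L hL z

theorem momSupp_mul_cutoff (f : PS n → ℂ) (m : ℕ) :
    MomSupp (2 * ((m : ℝ) + 1)) fun z => f z * cutoff ((1 / ((m : ℝ) + 1)) • z.2) := by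
  intro z hz
  have hm : (0 : ℝ) < m + 1 := by positivity
  have : cutoff ((1 / ((m : ℝ) + 1)) • z.2) = 0 := by
    refine cutoff_eq_zero ?_
    rw [norm_smul, Real.norm_of_nonneg (by positivity), one_div, ← div_eq_inv_mul,
      le_div_iff₀ hm]
    exact hz.le
  exact mul_eq_zero_of_right _ this

theorem tendsto_cutoff (p : Vec n) :
    Filter.Tendsto (fun m : ℕ => cutoff ((1 / ((m : ℝ) + 1)) • p)) Filter.atTop (nhds 1) := by
  have h1 := (tendsto_one_div_add_atTop_nhds_zero_nat (𝕜 := ℝ)).smul_const p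
  rw [zero_smul] at h1
  have h2 := (contDiff_cutoff (n := n)).continuous.tendsto 0
  rw [cutoff_zero] at h2
  exact h2.comp h1

end Cutoff

noncomputable section

/-- The inner integral of the operator with amplitude `f`. -/
def inner1 {n : ℕ} (f : PS n → ℂ) (u : Vec n → ℂ) (x p : Vec n) : ℂ :=
  ∫ y : Vec n, f ((x, y), p) * phase p x y * u y

/-- The iterated oscillatory integral with amplitude `f`. -/
def iterInt {n : ℕ} (f : PS n → ℂ) (u : Vec n → ℂ) (x : Vec n) : ℂ := ∫ p, inner1 f u x p

/-- Truncation of a function in the variable and in the value. -/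
def trunc {n : ℕ} (r : ℝ) (F : Vec n → ℂ) (x : Vec n) : ℂ :=
  if ‖x‖ ≤ r ∧ ‖F x‖ ≤ r then F x else 0

end

section Duality

variable {n : ℕ} {h : Fin n → ℝ} {M : ℕ} {D K : ℝ} {f : PS n → ℂ} {u v : Vec n → ℂ}

theorem stronglyMeasurable_inner1 (hf : Continuous f) (hu : Measurable u) :
    StronglyMeasurable fun z : Vec n × Vec n => inner1 f u z.1 z.2 := by
  refine StronglyMeasurable.integral_prod_right
    (f := fun (z : Vec n × Vec n) (y : Vec n) => f ((z.1, y), z.2) * phase z.2 z.1 y * u y) ?_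
  refine Measurable.stronglyMeasurable ?_
  have h1 : Continuous fun z : (Vec n × Vec n) × Vec n => f ((z.1.1, z.2), z.1.2) := by fun_prop
  have h2 : Continuous fun z : (Vec n × Vec n) × Vec n => phase z.1.2 z.1.1 z.2 := by
    unfold phase; fun_prop
  exact (h1.measurable.mul h2.measurable).mul (hu.comp measurable_snd)

theorem measurable_iterInt (hf : Continuous f) (hu : Measurable u) : Measurable (iterInt f u) :=
  (StronglyMeasurable.integral_prod_right (f := inner1 f u)
    (stronglyMeasurable_inner1 hf hu)).measurable

theorem bddSupp_trunc {F : Vec n → ℂ} (hF : Measurable F) (r : ℝ) : BddSupp (trunc r F) := by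
  refine ⟨?_, ⟨max r 0, fun x => ?_⟩, ⟨r, fun x hx => ?_⟩⟩
  · exact Measurable.ite ((measurableSet_le measurable_norm measurable_const).inter
      (measurableSet_le hF.norm measurable_const)) hF measurable_const
  · unfold trunc
    split_ifs with hc
    · exact hc.2.trans (le_max_left _ _)
    · simp
  · by_contra hc
    exact hx (if_neg fun h => hc h.1)

/-- Reordering of the variables `((x, y), p)` to `(x, (p, y))`. -/
theorem measurePreserving_reorder : MeasurePreserving
    (fun z : Vec n × (Vec n × Vec n) => (((z.1, z.2.2), z.2.1) : PS n)) volume volume := by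
  have h1 : MeasurePreserving (Prod.map id Prod.swap : Vec n × (Vec n × Vec n) → _) volume volume :=
    (MeasurePreserving.id (volume : Measure (Vec n))).prod Measure.measurePreserving_swap
  exact (volume_preserving_prodAssoc.symm MeasurableEquiv.prodAssoc).comp h1

theorem measurableEmbedding_reorder : MeasurableEmbedding
    (fun z : Vec n × (Vec n × Vec n) => (((z.1, z.2.2), z.2.1) : PS n)) :=
  (MeasurableEquiv.prodAssoc.symm.measurableEmbedding).comp
    (((MeasurableEquiv.refl (Vec n)).prodCongr MeasurableEquiv.prodComm).measurableEmbedding)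

theorem integral_mul_iterInt (hf : Continuous f) (hK : MomSupp K f) (hv : BddSupp v)
    (hu : BddSupp u) : ∫ x, v x * iterInt f u x = bil f v u := by
  have h1 := integrable_mul_kern_of_continuous hf hv hu hK
  have h2 := (measurePreserving_reorder.integrable_comp_emb measurableEmbedding_reorder).2 h1
  rw [bil, ← measurePreserving_reorder.integral_comp measurableEmbedding_reorder]
  rw [Measure.volume_eq_prod] at h2 ⊢
  refine Eq.trans ?_ (integral_prod _ h2).symm
  refine integral_congr_ae ?_
  filter_upwards [h2.prod_right_ae] with x hx
  rw [Measure.volume_eq_prod] at hx ⊢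
  refine Eq.trans ?_ (integral_prod _ hx).symm
  rw [iterInt, ← integral_const_mul]
  congr 1 with p
  rw [inner1, ← integral_const_mul]
  congr 1 with y
  simp only [Function.comp_apply, kern, phase_eq_osc_mul]
  ring

theorem pow_mul_L2_trunc_le [NeZero n] (hh : ∀ i, 0 < h i) (h0 : h 0 = 2) (N : ℕ) {j k : ℝ}
    (hM : 2 * n + (N + 2 * n) ≤ M) (hf : ContDiff ℝ (⊤ : ℕ∞) f)
    (hS : SymBound h {z | |z.1.1 0 - j| ≤ 1 ∧ |z.1.2 0 - k| ≤ 1} M D f) (hK : MomSupp K f)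
    (hu : BddSupp u) (huk : ∀ x, u x ≠ 0 → |x 0 - k| < 1) {w : Vec n → ℝ} (hw : Measurable w)
    (hw1 : ∀ x, ‖w x‖ ≤ 1) (hwj : ∀ x, w x ≠ 0 → |x 0 - j| < 1) (hD : 0 ≤ D) (r : ℝ) :
    (1 + |j - k| / 2) ^ N * L2 (trunc r fun x => (w x : ℂ) * iterInt f u x) ≤
      4 ^ (N + 2 * n) * (4 ^ n * (2 * π) ^ n) * schurConst ^ n * D * L2 u := by
  set F : Vec n → ℂ := fun x => (w x : ℂ) * iterInt f u x with hF
  have hwm : Measurable fun x => (w x : ℂ) := Complex.measurable_ofReal.comp hw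
  have hFm : Measurable F := hwm.mul (measurable_iterInt hf.continuous hu.meas)
  have hT := bddSupp_trunc hFm r
  have hTc : BddSupp fun x => (starRingEnd ℂ) (trunc r F x) :=
    ⟨Complex.continuous_conj.measurable.comp hT.meas, by simpa using hT.bdd, by simpa using hT.supp⟩
  have hv : BddSupp fun x => (w x : ℂ) * (starRingEnd ℂ) (trunc r F x) :=
    hTc.mul_bdd hwm fun x _ => by simpa using hw1 x
  have hsq : bil f (fun x => (w x : ℂ) * (starRingEnd ℂ) (trunc r F x)) u =
      ((L2 (trunc r F) ^ 2 : ℝ) : ℂ) := by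
    rw [← integral_mul_iterInt hf.continuous hK hv hu, L2_sq, ← integral_complex_ofReal]
    congr 1 with x
    have h1 : (w x : ℂ) * (starRingEnd ℂ) (trunc r F x) * iterInt f u x =
        (starRingEnd ℂ) (trunc r F x) * F x := by rw [hF]; ring
    rw [h1]
    by_cases hc : ‖x‖ ≤ r ∧ ‖F x‖ ≤ r
    · rw [trunc, if_pos hc, mul_comm, Complex.mul_conj']
      push_cast
      rfl
    · rw [trunc, if_neg hc]; simp
  have hmono : L2 (fun x => (w x : ℂ) * (starRingEnd ℂ) (trunc r F x)) ≤ L2 (trunc r F) := by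
    refine hT.L2_mono fun x => ?_
    rw [norm_mul, RCLike.norm_conj, Complex.norm_real]
    exact mul_le_of_le_one_left (norm_nonneg _) (hw1 x)
  have hmain := pow_mul_norm_bil_le hh h0 N hM hf hS hK hv hu
    (fun x hx => hwj x fun h => hx (by simp [h])) huk
  rw [hsq, Complex.norm_real, Real.norm_of_nonneg (by positivity)] at hmain
  have hs := schurConst_nonneg
  have hLu := L2_nonneg u
  rcases (L2_nonneg (trunc r F)).eq_or_lt with hz | hz
  · rw [← hz, mul_zero]; positivity
  · refine le_of_mul_le_mul_right ?_ hz
    calc _ = (1 + |j - k| / 2) ^ N * L2 (trunc r F) ^ 2 := by ring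
      _ ≤ _ := hmain
      _ ≤ 4 ^ (N + 2 * n) * (4 ^ n * (2 * π) ^ n) * schurConst ^ n * D * L2 (trunc r F) * L2 u := by
        gcongr
      _ = _ := by ring

end Duality

section Limit

variable {n : ℕ}

/-- Fatou's lemma for the `L²` norm. -/
theorem L2_le_of_tendsto {F : Vec n → ℂ} {G : ℕ → Vec n → ℂ} {E : ℝ} (hF : Measurable F)
    (hG : ∀ m, BddSupp (G m)) (hE0 : 0 ≤ E) (hE : ∀ᶠ m in Filter.atTop, L2 (G m) ≤ E)
    (hlim : ∀ x, F x ≠ 0 → Filter.Tendsto (fun m => G m x) Filter.atTop (nhds (F x))) :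
    L2 F ≤ E := by
  have h1 : ∫⁻ x, ENNReal.ofReal (‖F x‖ ^ 2) ≤ ENNReal.ofReal (E ^ 2) := by
    calc ∫⁻ x, ENNReal.ofReal (‖F x‖ ^ 2)
        ≤ ∫⁻ x, Filter.liminf (fun m => ENNReal.ofReal (‖G m x‖ ^ 2)) Filter.atTop := by
          refine lintegral_mono fun x => ?_
          by_cases hx : F x = 0
          · simp [hx]
          · exact ((ENNReal.continuous_ofReal.tendsto _).comp
              (((hlim x hx).norm).pow 2)).liminf_eq.ge
      _ ≤ Filter.liminf (fun m => ∫⁻ x, ENNReal.ofReal (‖G m x‖ ^ 2)) Filter.atTop :=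
          lintegral_liminf_le fun m => ((hG m).meas.norm.pow_const 2).ennreal_ofReal
      _ ≤ ENNReal.ofReal (E ^ 2) := by
          refine Filter.liminf_le_of_frequently_le' (Filter.Eventually.frequently ?_)
          filter_upwards [hE] with m hm
          rw [← ofReal_integral_eq_lintegral_ofReal (hG m).integrable_sq
            (Filter.Eventually.of_forall fun x => by positivity), ← L2_sq]
          have := L2_nonneg (G m)
          gcongr
  refine Real.sqrt_le_iff.2 ⟨hE0, ?_⟩
  rw [integral_eq_lintegral_of_nonneg_ae (Filter.Eventually.of_forall fun x => by positivity)
    (hF.norm.pow_const 2).aestronglyMeasurable]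
  exact ENNReal.toReal_le_of_le_ofReal (by positivity) h1

theorem tendsto_iterInt_cutoff {f : PS n → ℂ} {u : Vec n → ℂ} {x : Vec n}
    (hx : Integrable (inner1 f u x)) :
    Filter.Tendsto (fun m : ℕ =>
      iterInt (fun z => f z * cutoff ((1 / ((m : ℝ) + 1)) • z.2)) u x) Filter.atTop
      (nhds (iterInt f u x)) := by
  have h1 : ∀ (m : ℕ) (p : Vec n),
      inner1 (fun z => f z * cutoff ((1 / ((m : ℝ) + 1)) • z.2)) u x p =
        cutoff ((1 / ((m : ℝ) + 1)) • p) * inner1 f u x p := by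
    intro m p
    rw [inner1, inner1, ← integral_const_mul]
    congr 1 with y
    ring
  simp only [iterInt, h1]
  refine tendsto_integral_of_dominated_convergence (fun p => ‖inner1 f u x p‖) (fun m => ?_)
    hx.norm (fun m => Filter.Eventually.of_forall fun p => ?_)
    (Filter.Eventually.of_forall fun p => ?_)
  · refine Continuous.aestronglyMeasurable ?_ |>.mul hx.aestronglyMeasurable
    exact contDiff_cutoff.continuous.comp (by fun_prop)
  · rw [norm_mul]
    exact mul_le_of_le_one_left (norm_nonneg _) (norm_cutoff_le _)
  · simpa using (tendsto_cutoff p).mul_const (inner1 f u x p)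

theorem tendsto_trunc_iterInt {f : PS n → ℂ} {u : Vec n → ℂ} {w : Vec n → ℝ} {x : Vec n}
    (hx : (w x : ℂ) * iterInt f u x ≠ 0) :
    Filter.Tendsto (fun m : ℕ => trunc m (fun x => (w x : ℂ) *
      iterInt (fun z => f z * cutoff ((1 / ((m : ℝ) + 1)) • z.2)) u x) x) Filter.atTop
      (nhds ((w x : ℂ) * iterInt f u x)) := by
  have hint : Integrable (inner1 f u x) := by
    by_contra hc
    exact hx (by rw [iterInt, integral_undef hc, mul_zero])
  have h1 := (tendsto_iterInt_cutoff hint).const_mul (w x : ℂ)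
  refine h1.congr' ?_
  filter_upwards [h1.norm.eventually_le_const (lt_add_one _), Filter.eventually_ge_atTop ⌈‖x‖⌉₊,
    Filter.eventually_ge_atTop ⌈‖(w x : ℂ) * iterInt f u x‖ + 1⌉₊] with m hm1 hm2 hm3
  rw [trunc, if_pos ⟨Nat.ceil_le.1 hm2, hm1.trans (Nat.ceil_le.1 hm3)⟩]

theorem bisymSeminorm_nonneg [NeZero n] {lam : ℝ → ℝ} (hlam : ∀ r, 0 < lam r) {t : ℝ}
    {a : Vec n → Vec n → Vec n → ℂ} (ha : IsBisymbol lam 0 0 t a) (M : ℕ) :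
    0 ≤ bisymSeminorm lam M 0 0 t a := by
  have h := (norm_nonneg _).trans
    ((symBound_of_isBisymbol hlam ha M 0 0).norm_le (z := 0) (by simp))
  exact nonneg_of_mul_nonneg_right h (by positivity)

theorem pow_mul_L2_iterInt_le [NeZero n] {h : Fin n → ℝ} {M : ℕ} {D : ℝ} {f : PS n → ℂ}
    {u : Vec n → ℂ} (hh : ∀ i, 0 < h i) (h0 : h 0 = 2) (N : ℕ) {j k : ℝ}
    (hM : 2 * n + (N + 2 * n) ≤ M) (hf : ContDiff ℝ (⊤ : ℕ∞) f)
    (hS : SymBound h {z | |z.1.1 0 - j| ≤ 1 ∧ |z.1.2 0 - k| ≤ 1} M D f)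
    (hu : BddSupp u) (huk : ∀ x, u x ≠ 0 → |x 0 - k| < 1) {w : Vec n → ℝ} (hw : Measurable w)
    (hw1 : ∀ x, ‖w x‖ ≤ 1) (hwj : ∀ x, w x ≠ 0 → |x 0 - j| < 1) (hD : 0 ≤ D) :
    (1 + |j - k| / 2) ^ N * L2 (fun x => (w x : ℂ) * iterInt f u x) ≤
      4 ^ (N + 2 * n) * (4 ^ n * (2 * π) ^ n) * schurConst ^ n * (2 ^ M * D) * L2 u := by
  have hs := schurConst_nonneg
  have hLu := L2_nonneg u
  have hwm : Measurable fun x => (w x : ℂ) := Complex.measurable_ofReal.comp hw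
  have hfm : ∀ m : ℕ, ContDiff ℝ (⊤ : ℕ∞)
      fun z : PS n => f z * cutoff ((1 / ((m : ℝ) + 1)) • z.2) := fun m =>
    hf.mul (contDiff_cutoff.comp (by fun_prop))
  rw [mul_comm, ← le_div_iff₀ (by positivity)]
  refine L2_le_of_tendsto (hwm.mul (measurable_iterInt hf.continuous hu.meas)) (fun m =>
    bddSupp_trunc (hwm.mul (measurable_iterInt (hfm m).continuous hu.meas)) m) (by positivity) ?_
    fun x => tendsto_trunc_iterInt
  filter_upwards [eventually_symBound_cutoff hh M] with m hm
  rw [le_div_iff₀ (by positivity), mul_comm]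
  have hS' := hS.mul hh hf (contDiff_cutoff.comp (by fun_prop))
    (hm.mono (Set.subset_univ _) le_rfl le_rfl)
  rw [mul_one] at hS'
  exact pow_mul_L2_trunc_le hh h0 N hM (hfm m) hS' (momSupp_mul_cutoff f m) hu huk hw hw1 hwj
    (by positivity) m

end Limit

section Partition

theorem abs_le_one_of_tsum {ψ : ℝ → ℝ} (hpos : ∀ r, 0 ≤ ψ r)
    (hsum : ∀ r : ℝ, ∑' j : ℤ, ψ (r - j) = 1) (r : ℝ) : |ψ r| ≤ 1 := by
  have hs : Summable fun j : ℤ => ψ (r - j) := by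
    by_contra hc
    have := hsum r
    rw [tsum_eq_zero_of_not_summable hc] at this
    exact zero_ne_one this
  have := hs.le_tsum 0 fun j _ => hpos _
  rw [hsum] at this
  rw [abs_of_nonneg (hpos r)]
  simpa using this

theorem inv_pow_le_sqrt_zpow (d : ℝ) (N : ℕ) :
    ((1 + |d| / 2) ^ N)⁻¹ ≤ 2 ^ N * Real.sqrt (1 + d ^ 2) ^ (-(N : ℤ)) := by
  have h0 : 0 < Real.sqrt (1 + d ^ 2) := Real.sqrt_pos.2 (by positivity)
  have h1 : Real.sqrt (1 + d ^ 2) ≤ 2 * (1 + |d| / 2) := by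
    refine Real.sqrt_le_iff.2 ⟨by positivity, ?_⟩
    nlinarith [abs_nonneg d, sq_abs d]
  rw [zpow_neg, zpow_natCast, inv_le_iff_one_le_mul₀ (by positivity), mul_right_comm,
    ← div_eq_mul_inv, le_div_iff₀ (by positivity), one_mul, ← mul_pow]
  gcongr

end Partition

/-- **Proposition 3.1.**  Let `λ` satisfy the admissibility condition and let
`ψ ∈ C_c^∞((-1,1))`, `ψ ≥ 0`, with `∑_{j ∈ ℤ} ψ(r - j) = 1`.  For every `N ≥ 0`
there are `C = C_N > 0` and `M = M_N ≥ 0` such that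
`‖ψ_j Op(a) ψ_k u‖_{L²} ≤ C |a|_{λ:M,0,0,t} ⟨j-k⟩^{-N} ‖u‖_{L²}`
for all `t ∈ [0,1]`, all `a ∈ BS⁰₀(λ;t)`, all `j, k ∈ ℤ` and all `u ∈ C_c^∞(ℝⁿ)`. -/
theorem psi_Op_psi_decay
    (n : ℕ) [NeZero n] (lam : ℝ → ℝ) (hlam : Admissible lam)
    (ψ : ℝ → ℝ) (hψ : ContDiff ℝ (⊤ : ℕ∞) ψ) (hψsupp : tsupport ψ ⊆ Set.Ioo (-1 : ℝ) 1)
    (hψpos : ∀ r, 0 ≤ ψ r) (hψsum : ∀ r : ℝ, ∑' j : ℤ, ψ (r - j) = 1) (N : ℕ) :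
    ∃ C > 0, ∃ M : ℕ, ∀ t ∈ Set.Icc (0 : ℝ) 1,
      ∀ a : Vec n → Vec n → Vec n → ℂ, IsBisymbol lam 0 0 t a →
        ∀ j k : ℤ, ∀ u : Vec n → ℂ, ContDiff ℝ (⊤ : ℕ∞) u → HasCompactSupport u →
          L2 (fun q => (ψ (q 0 - j) : ℂ) *
                Op a (fun q' => (ψ (q' 0 - k) : ℂ) * u q') q)
            ≤ C * bisymSeminorm lam M 0 0 t a *
                Real.sqrt (1 + ((j : ℝ) - k) ^ 2) ^ (-(N : ℤ)) * L2 u := by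
  have hs := schurConst_nonneg
  set M := 2 * n + (N + 2 * n) with hM
  set C := 4 ^ (N + 2 * n) * (4 ^ n * (2 * π) ^ n) * schurConst ^ n *
    (2 ^ M * 2 ^ M) * 2 ^ N with hC
  have hC0 : 0 ≤ C := by positivity
  refine ⟨C + 1, by positivity, M, fun t _ a ha j k u hu huc => ?_⟩
  have hψ1 := abs_le_one_of_tsum hψpos hψsum
  have hψ0 : ∀ s, ψ s ≠ 0 → |s| < 1 := fun s hs =>
    abs_lt.2 (hψsupp (subset_tsupport _ hs))
  have hψm : ∀ c : ℝ, Measurable fun x : Vec n => ψ (x 0 - c) := fun c =>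
    (hψ.continuous.comp (by fun_prop)).measurable
  have hψmC : Measurable fun x : Vec n => (ψ (x 0 - k) : ℂ) :=
    Complex.measurable_ofReal.comp (hψm k)
  have hbu : BddSupp u := by
    obtain ⟨r, hr⟩ := huc.isCompact.isBounded.subset_closedBall 0
    exact ⟨hu.continuous.measurable, huc.exists_bound_of_continuous hu.continuous,
      ⟨r, fun x hx => by simpa using hr (subset_tsupport _ hx)⟩⟩
  have hbw : BddSupp fun q' : Vec n => (ψ (q' 0 - k) : ℂ) * u q' :=
    hbu.mul_bdd hψmC fun x _ => by simpa using hψ1 _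
  have hh : ∀ i : Fin n, 0 < if i = 0 then (2 : ℝ) else (lamT lam t j k)⁻¹ := fun i => by
    split_ifs
    · norm_num
    · exact inv_pos.2 (hlam.1 _)
  have hsn := bisymSeminorm_nonneg hlam.1 ha M
  set w : Vec n → ℝ := fun q => (2 * π) ^ (-(n : ℤ)) * ψ (q 0 - j) with hw
  have hpi : (2 * π) ^ (-(n : ℤ)) ≤ 1 := by
    rw [zpow_neg, zpow_natCast]
    exact inv_le_one_of_one_le₀ (one_le_pow₀ (by linarith [Real.pi_gt_three]))
  have key := pow_mul_L2_iterInt_le (w := w) hh (if_pos rfl) N hM.ge (contDiff_symbol ha)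
    (symBound_of_isBisymbol hlam.1 ha M j k) hbw
    (fun x hx => hψ0 _ fun h => hx (by simp [h])) ((hψm j).const_mul _)
    (fun x => by
      rw [hw, norm_mul, Real.norm_of_nonneg (by positivity)]
      exact mul_le_one₀ hpi (norm_nonneg _) (hψ1 _))
    (fun x hx => hψ0 _ (right_ne_zero_of_mul hx)) (by positivity)
  have hOp : (fun q : Vec n => (ψ (q 0 - j) : ℂ) * Op a (fun q' => (ψ (q' 0 - k) : ℂ) * u q') q) =
      fun x => (w x : ℂ) * iterInt (fun z => a z.1.1 z.2 z.1.2)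
        (fun q' => (ψ (q' 0 - k) : ℂ) * u q') x := by
    ext q
    simp only [Op, hw, iterInt, inner1]
    push_cast
    ring
  have hL : L2 (fun q' : Vec n => (ψ (q' 0 - k) : ℂ) * u q') ≤ L2 u := by
    refine hbu.L2_mono fun x => ?_
    rw [norm_mul, Complex.norm_real]
    exact mul_le_of_le_one_left (norm_nonneg _) (hψ1 _)
  have hLu := L2_nonneg u
  rw [hOp]
  set R := Real.sqrt (1 + ((j : ℝ) - k) ^ 2) ^ (-(N : ℤ)) with hR
  have hR0 : 0 ≤ R := by positivity
  rw [← le_div_iff₀' (by positivity)] at key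
  calc _ ≤ _ := key
    _ ≤ (4 ^ (N + 2 * n) * (4 ^ n * (2 * π) ^ n) * schurConst ^ n *
          (2 ^ M * (2 ^ M * bisymSeminorm lam M 0 0 t a)) * L2 u) * (2 ^ N * R) := by
        rw [div_eq_mul_inv]
        gcongr
        exact inv_pow_le_sqrt_zpow _ N
    _ = C * bisymSeminorm lam M 0 0 t a * R * L2 u := by rw [hC]; ring
    _ ≤ _ := by
        gcongr
        linarith
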